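/- arXiv:0712.3675 — 7 statements merged into one kernel-verified Lean document; each statement's English description precedes it below -/
import Mathlib

section
/- Let φ₁, φ₂, φ₃ be nonzero vectors in ℂ² that are pairwise linearly independent (no one is a scalar multiple of another). Then the three vectors φ₁ ⊗ φ₁, φ₂ ⊗ φ₂, φ₃ ⊗ φ₃ are linearly independent in ℂ² ⊗ ℂ². -/
/-- The tensor (Kronecker) product of two vectors in `ℂ²`, as a vector in `ℂ² ⊗ ℂ²`. -/
def tensorC2 (φ χ : Fin 2 → ℂ) : Fin 2 × Fin 2 → ℂ := fun p => φ p.1 * χ p.2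

/-- Linearly independent vectors in `ℂ²` have nonzero determinant. -/
theorem det_ne_zero_of_pair (a b : Fin 2 → ℂ) (h : LinearIndependent ℂ ![a, b]) :
    a 0 * b 1 - a 1 * b 0 ≠ 0 := by
  have h1 : IsUnit (Matrix.of ![a, b]) :=
    Matrix.linearIndependent_rows_iff_isUnit.mp h
  have h2 := ((Matrix.isUnit_iff_isUnit_det _).mp h1).ne_zero
  rw [Matrix.det_fin_two] at h2
  simpa using h2

/-- If `φ₁, φ₂, φ₃` are pairwise linearly independent vectors in `ℂ²`, then
`φ₁ ⊗ φ₁, φ₂ ⊗ φ₂, φ₃ ⊗ φ₃` are linearly independent in `ℂ² ⊗ ℂ²`. -/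
theorem tensor_squares_linearIndependent
    (φ₁ φ₂ φ₃ : Fin 2 → ℂ)
    (h12 : LinearIndependent ℂ ![φ₁, φ₂])
    (h13 : LinearIndependent ℂ ![φ₁, φ₃])
    (h23 : LinearIndependent ℂ ![φ₂, φ₃]) :
    LinearIndependent ℂ ![tensorC2 φ₁ φ₁, tensorC2 φ₂ φ₂, tensorC2 φ₃ φ₃] := by
  have d12 := det_ne_zero_of_pair _ _ h12
  have d13 := det_ne_zero_of_pair _ _ h13
  have d23 := det_ne_zero_of_pair _ _ h23
  rw [Fintype.linearIndependent_iff]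
  intro g hg
  have e : ∀ i j : Fin 2, g 0 * (φ₁ i * φ₁ j) + g 1 * (φ₂ i * φ₂ j)
      + g 2 * (φ₃ i * φ₃ j) = 0 := by
    intro i j
    have := congrFun hg (i, j)
    simpa [Fin.sum_univ_three, tensorC2] using this
  -- a functional `v ↦ det (a, v) * det (b, v)` kills the squares of `a` and `b`
  have k (a b : Fin 2 → ℂ) :
      g 0 * ((a 0 * φ₁ 1 - a 1 * φ₁ 0) * (b 0 * φ₁ 1 - b 1 * φ₁ 0))
      + g 1 * ((a 0 * φ₂ 1 - a 1 * φ₂ 0) * (b 0 * φ₂ 1 - b 1 * φ₂ 0))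
      + g 2 * ((a 0 * φ₃ 1 - a 1 * φ₃ 0) * (b 0 * φ₃ 1 - b 1 * φ₃ 0)) = 0 := by
    linear_combination a 0 * b 0 * e 1 1 - a 0 * b 1 * e 1 0 - a 1 * b 0 * e 0 1
      + a 1 * b 1 * e 0 0
  have g2 : g 2 = 0 := by
    have : g 2 * ((φ₁ 0 * φ₃ 1 - φ₁ 1 * φ₃ 0) * (φ₂ 0 * φ₃ 1 - φ₂ 1 * φ₃ 0)) = 0 := by
      linear_combination k φ₁ φ₂
    exact (mul_eq_zero.mp this).resolve_right (mul_ne_zero d13 d23)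
  have g1 : g 1 = 0 := by
    have : g 1 * ((φ₁ 0 * φ₂ 1 - φ₁ 1 * φ₂ 0) * (φ₂ 0 * φ₃ 1 - φ₂ 1 * φ₃ 0)) = 0 := by
      linear_combination -k φ₁ φ₃
    exact (mul_eq_zero.mp this).resolve_right (mul_ne_zero d12 d23)
  have g0 : g 0 = 0 := by
    have : g 0 * ((φ₁ 0 * φ₂ 1 - φ₁ 1 * φ₂ 0) * (φ₁ 0 * φ₃ 1 - φ₁ 1 * φ₃ 0)) = 0 := by
      linear_combination k φ₂ φ₃
    exact (mul_eq_zero.mp this).resolve_right (mul_ne_zero d12 d13)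
  intro i
  fin_cases i
  · exact g0
  · exact g1
  · exact g2
end

section
/- Let A₁,…,A_k and B₁,…,B_k be two k-outcome POVMs on ℂ², and assume at least two of the effects B_j are nonzero. Suppose there exists a state ρ on ℂ² ⊗ ℂ² such that tr(ρ (A_j ⊗ A_j)) = 0 for every j and tr(ρ (B_i ⊗ B_j)) = 0 for every pair i ≠ j. Then there exist an orthonormal basis {φ, φ⊥} of ℂ² and a real number r such that: every A_j is a nonnegative multiple of |φ⟩⟨φ| or of |φ⊥⟩⟨φ⊥|; exactly two effects of B are nonzero, and these two equal |φ₊⟩⟨φ₊| and |φ₋⟩⟨φ₋| respectively, where φ± = (φ ± e^{ir} φ⊥)/√2. -/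
open Matrix Kronecker ComplexOrder

lemma aux_factor {n : Type*} [Fintype n] [DecidableEq n] (P : Matrix n n ℂ)
    (hP : P.PosSemidef) : ∃ R : Matrix n n ℂ, P = Rᴴ * R := by
  open scoped MatrixOrder in
  exact CStarAlgebra.nonneg_iff_eq_star_mul_self.mp hP.nonneg

lemma aux_trace {n : Type*} [Fintype n] [DecidableEq n] (P Q : Matrix n n ℂ)
    (hP : P.PosSemidef) (hQ : Q.PosSemidef) (h : (P * Q).trace = 0) : Q * P = 0 := by
  obtain ⟨R, rfl⟩ := aux_factor P hP
  obtain ⟨S, rfl⟩ := aux_factor Q hQ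
  have h1 : ((S * Rᴴ)ᴴ * (S * Rᴴ)).trace = 0 := by
    rw [← h, Matrix.conjTranspose_mul, Matrix.conjTranspose_conjTranspose, Matrix.mul_assoc,
      Matrix.trace_mul_comm R, Matrix.trace_mul_comm (Rᴴ * R)]
    simp only [Matrix.mul_assoc]
  rw [Matrix.trace_conjTranspose_mul_self_eq_zero_iff] at h1
  calc Sᴴ * S * (Rᴴ * R) = Sᴴ * (S * Rᴴ) * R := by simp only [Matrix.mul_assoc]
    _ = 0 := by simp [h1]

lemma aux_kron (ρ : Matrix (Fin 2 × Fin 2) (Fin 2 × Fin 2) ℂ) (hρ : ρ.PosSemidef)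
    (M N : Matrix (Fin 2) (Fin 2) ℂ) (hM : M.PosSemidef) (hN : N.PosSemidef)
    (h : (ρ * (M ⊗ₖ N)).trace = 0) (q : Fin 2 × Fin 2) :
    M * (Matrix.of fun i j => ρ (i, j) q) * Nᵀ = 0 := by
  have h1 := aux_trace ρ (M ⊗ₖ N) hρ (hM.kronecker hN) h
  ext i j
  have h2 := congrFun (congrFun h1 (i, j)) q
  simp [Matrix.mul_apply, Fintype.sum_prod_type, Fin.sum_univ_two] at h2 ⊢
  linear_combination h2

lemma aux_unitary (A : Matrix (Fin 2) (Fin 2) ℂ) (hA : A.IsHermitian) (h0 : A ≠ 0) :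
    ∃ U : Matrix (Fin 2) (Fin 2) ℂ, U * Uᴴ = 1 ∧ Uᴴ * U = 1 ∧
      (Uᴴ * A * U) 0 0 ≠ 0 ∧ (Uᴴ * A * U) 0 1 = 0 := by
  have hs := hA.spectral_theorem
  set E := hA.eigenvectorUnitary with hE
  set D : Matrix (Fin 2) (Fin 2) ℂ := diagonal (RCLike.ofReal ∘ hA.eigenvalues) with hD
  rw [Unitary.conjStarAlgAut_apply] at hs
  have e1 : (E : Matrix (Fin 2) (Fin 2) ℂ) * (E : Matrix (Fin 2) (Fin 2) ℂ)ᴴ = 1 := Unitary.coe_mul_star_self E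
  have e2 : (E : Matrix (Fin 2) (Fin 2) ℂ)ᴴ * (E : Matrix (Fin 2) (Fin 2) ℂ) = 1 := Unitary.coe_star_mul_self E
  rw [star_eq_conjTranspose] at hs
  generalize (E : Matrix (Fin 2) (Fin 2) ℂ) = V at *
  have hd : Vᴴ * A * V = D := by
    rw [hs]
    calc Vᴴ * (V * D * Vᴴ) * V = (Vᴴ * V) * D * (Vᴴ * V) := by simp only [Matrix.mul_assoc]
      _ = D := by simp [e2]
  by_cases h : hA.eigenvalues 0 = 0
  · have h1 : hA.eigenvalues 1 ≠ 0 := by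
      intro h1
      apply h0
      rw [hs]
      have : D = 0 := by
        rw [hD]; ext i j; fin_cases i <;> fin_cases j <;> simp [h, h1]
      simp [this]
    have s1 : (!![0,1;1,0] : Matrix (Fin 2) (Fin 2) ℂ)ᴴ = !![0,1;1,0] := by
      ext i j; fin_cases i <;> fin_cases j <;> simp
    have s2 : (!![0,1;1,0] : Matrix (Fin 2) (Fin 2) ℂ) * !![0,1;1,0] = 1 := by
      ext i j; fin_cases i <;> fin_cases j <;> simp
    have h3 : (V * !![0,1;1,0])ᴴ * A * (V * !![0,1;1,0]) = !![0,1;1,0] * D * !![0,1;1,0] := by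
      rw [Matrix.conjTranspose_mul, s1, ← hd]; simp only [Matrix.mul_assoc]
    refine ⟨V * !![0,1;1,0], ?_, ?_, ?_, ?_⟩
    · rw [Matrix.conjTranspose_mul, s1, Matrix.mul_assoc, ← Matrix.mul_assoc _ _ Vᴴ, s2, Matrix.one_mul, e1]
    · rw [Matrix.conjTranspose_mul, s1, Matrix.mul_assoc, ← Matrix.mul_assoc Vᴴ, e2, Matrix.one_mul, s2]
    · rw [h3]; simp [hD, Matrix.mul_apply, Fin.sum_univ_two, Matrix.vecMul_diagonal, h1]
    · rw [h3]; simp [hD, Matrix.mul_apply, Fin.sum_univ_two, Matrix.vecMul_diagonal]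
  · exact ⟨V, e1, e2, by rw [hd]; simpa [hD] using h, by rw [hd]; simp [hD]⟩

lemma aux_entries (A : Matrix (Fin 2) (Fin 2) ℂ) (hA : A.PosSemidef) :
    ∃ (a d : ℝ) (b : ℂ), 0 ≤ a ∧ 0 ≤ d ∧ (d = 0 → b = 0) ∧
      A = !![(a : ℂ), b; star b, (d : ℂ)] := by
  have h0 := hA.diag_nonneg (i := 0)
  have h1 := hA.diag_nonneg (i := 1)
  have hh := hA.1.apply 1 0
  have hdet := hA.det_nonneg
  rw [Matrix.det_fin_two] at hdet
  rw [Complex.le_def] at h0 h1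
  have e0 : A 0 0 = ((A 0 0).re : ℂ) := by apply Complex.ext <;> simp [← h0.2]
  have e1 : A 1 1 = ((A 1 1).re : ℂ) := by apply Complex.ext <;> simp [← h1.2]
  refine ⟨(A 0 0).re, (A 1 1).re, A 0 1, h0.1, h1.1, ?_, ?_⟩
  · intro h
    rw [e1, h, ← hh] at hdet
    have := (Complex.le_def.mp hdet).1
    simp at this
    apply Complex.ext <;> simp <;> nlinarith [sq_nonneg (A 0 1).re, sq_nonneg (A 0 1).im]
  · ext i j
    fin_cases i <;> fin_cases j
    · simpa using e0
    · simp
    · simpa using hh.symm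
    · simpa using e1

lemma aux_core (k : ℕ) (A B : Fin k → Matrix (Fin 2) (Fin 2) ℂ)
    (hApos : ∀ j, (A j).PosSemidef) (hAsum : ∑ j, A j = 1)
    (hBpos : ∀ j, (B j).PosSemidef) (hBsum : ∑ j, B j = 1)
    (hBtwo : ∃ i j, i ≠ j ∧ B i ≠ 0 ∧ B j ≠ 0)
    (X : Matrix (Fin 2) (Fin 2) ℂ) (hX : X ≠ 0)
    (hA : ∀ j, A j * X * (A j)ᵀ = 0)
    (hB : ∀ i j, i ≠ j → B i * X * (B j)ᵀ = 0)
    (j0 : Fin k) (h00 : A j0 0 0 ≠ 0) (h01 : A j0 0 1 = 0) :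
    ∃ r : ℝ,
      (∀ j, ∃ t : ℝ, 0 ≤ t ∧ (A j = !![(t : ℂ), 0; 0, 0] ∨ A j = !![0, 0; 0, (t : ℂ)])) ∧
      ∃ i j, i ≠ j ∧
        B i = !![1/2, star (Complex.exp (r * Complex.I)) / 2; Complex.exp (r * Complex.I) / 2, 1/2] ∧
        B j = !![1/2, -star (Complex.exp (r * Complex.I)) / 2; -Complex.exp (r * Complex.I) / 2, 1/2] ∧
        (∀ l, l ≠ i → l ≠ j → B l = 0) := by
  choose a d b ha hd hdb hAe using fun j => aux_entries (A j) (hApos j)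
  choose p s q hp hs hsq hBe using fun j => aux_entries (B j) (hBpos j)
  -- the state vector is swapped by the effects
  have hBX : ∀ i, B i * X = X * (B i)ᵀ := by
    intro i
    have e1 : B i * X = B i * X * (B i)ᵀ := by
      calc B i * X = B i * X * (∑ j, B j)ᵀ := by simp [hBsum]
        _ = ∑ j, B i * X * (B j)ᵀ := by rw [Matrix.transpose_sum, Matrix.mul_sum]
        _ = _ := Finset.sum_eq_single i (fun j _ hj => hB i j hj.symm) (by simp)
    have e2 : X * (B i)ᵀ = B i * X * (B i)ᵀ := by
      calc X * (B i)ᵀ = (∑ j, B j) * X * (B i)ᵀ := by simp [hBsum]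
        _ = ∑ j, B j * X * (B i)ᵀ := by simp only [Matrix.sum_mul]
        _ = _ := Finset.sum_eq_single i (fun j _ hj => hB j i hj) (by simp)
    rw [e1, ← e2]
  have hBBX : ∀ i j, i ≠ j → B i * B j * X = 0 := by
    intro i j hij
    rw [Matrix.mul_assoc, hBX j, ← Matrix.mul_assoc, hB i j hij]
  have hX00 : X 0 0 = 0 := by
    have h := congrFun (congrFun (hA j0) 0) 0
    simp [Matrix.mul_apply, Fin.sum_univ_two, h01, h00] at h
    exact h
  obtain ⟨α, β, γ, rfl⟩ : ∃ α β γ : ℂ, X = !![0, α; β, γ] :=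
    ⟨X 0 1, X 1 0, X 1 1, by ext i j; fin_cases i <;> fin_cases j <;> simp [hX00]⟩
  have hsumd : ∑ j, (d j : ℂ) = 1 := by
    have h := congrFun (congrFun hAsum 1) 1
    simp only [Matrix.sum_apply, hAe] at h
    simpa using h
  have hsumb : ∑ j, star (b j) = 0 := by
    have h := congrFun (congrFun hAsum 1) 0
    simp only [Matrix.sum_apply, hAe] at h
    simpa using h
  have hkey : ∀ j, (α + β) * star (b j) + γ * d j = 0 := by
    intro j
    by_cases h0 : d j = 0
    · simp [h0, hdb j h0]
    · have h := congrFun (congrFun (hA j) 1) 1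
      rw [hAe j] at h
      simp only [Matrix.mul_apply, Fin.sum_univ_two, Matrix.transpose_apply] at h
      have h0' : (d j : ℂ) ≠ 0 := by exact_mod_cast h0
      apply mul_left_cancel₀ h0'
      simp at h
      simp only [mul_zero, Complex.star_def]
      linear_combination h
  have hγ : γ = 0 := by
    have h : ∑ j, ((α + β) * star (b j) + γ * d j) = 0 := Finset.sum_eq_zero fun j _ => hkey j
    rw [Finset.sum_add_distrib, ← Finset.mul_sum, ← Finset.mul_sum, hsumb, hsumd] at h
    simpa using h
  subst hγ
  have hαβ : α ≠ 0 ∨ β ≠ 0 := by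
    by_contra! h
    apply hX
    ext i j; fin_cases i <;> fin_cases j <;> simp [h.1, h.2]
  have hps : ∀ i, p i = s i := by
    intro i
    have h1 := congrFun (congrFun (hBX i) 0) 1
    have h2 := congrFun (congrFun (hBX i) 1) 0
    rw [hBe i] at h1 h2
    simp [Matrix.mul_apply, Fin.sum_univ_two] at h1 h2
    rcases hαβ with h | h
    · have : (p i : ℂ) = s i := mul_left_cancel₀ h (by linear_combination h1)
      exact_mod_cast this
    · have : (p i : ℂ) = s i := mul_left_cancel₀ h (by linear_combination -h2)
      exact_mod_cast this
  have hqβ : ∀ i, q i * (α - β) = 0 := by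
    intro i
    have h1 := congrFun (congrFun (hBX i) 0) 0
    rw [hBe i] at h1
    simp [Matrix.mul_apply, Fin.sum_univ_two] at h1
    linear_combination -h1
  obtain ⟨i, j, hij, hi, hj⟩ := hBtwo
  have hp0 : ∀ i, B i ≠ 0 → p i ≠ 0 := by
    intro i hi h
    have h' : s i = 0 := by rw [← hps i, h]
    apply hi
    rw [hBe i, hsq i h', h, h']
    ext i j; fin_cases i <;> fin_cases j <;> simp
  have hαβe : α = β := by
    by_contra hne
    have hq : ∀ i, q i = 0 := fun i => by
      have := hqβ i
      rcases mul_eq_zero.mp this with h | h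
      · exact h
      · exact absurd (sub_eq_zero.mp h) hne
    have h := hBBX i j hij
    have h1 := congrFun (congrFun h 0) 1
    have h2 := congrFun (congrFun h 1) 0
    rw [hBe i, hBe j, hq i, hq j] at h1 h2
    have hpi := hp0 i hi
    have hpj := hp0 j hj
    rw [← hps i, ← hps j] at h1 h2
    simp [Matrix.mul_apply, Fin.sum_univ_two, hpi, hpj] at h1 h2
    rcases hαβ with h | h
    · exact h h1
    · exact h h2
  subst hαβe
  have hα : α ≠ 0 := by rcases hαβ with h | h <;> exact h
  -- the A part
  have hb0 : ∀ j, b j = 0 := by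
    intro j
    have h := hkey j
    have h2 : (α + α) ≠ 0 := by rw [← two_mul]; simpa using hα
    simpa [h2, hα] using h
  have had : ∀ j, a j = 0 ∨ d j = 0 := by
    intro j
    have h1 := congrFun (congrFun (hA j) 0) 1
    rw [hAe j, hb0 j] at h1
    simpa [Matrix.mul_apply, Fin.sum_univ_two, hα] using h1
  -- the B part
  have hBB : ∀ i j, i ≠ j → B i * B j = 0 := by
    intro i j hij
    have h := hBBX i j hij
    ext m n
    have h0 := congrFun (congrFun h m) 0
    have h1 := congrFun (congrFun h m) 1
    rw [Matrix.mul_apply, Fin.sum_univ_two] at h0 h1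
    fin_cases n
    · simpa [hα] using h1
    · simpa [hα] using h0
  have hBid : ∀ i, B i * B i = B i := by
    intro i
    calc B i * B i = ∑ j, B i * B j :=
          (Finset.sum_eq_single i (fun j _ hj => hBB i j hj.symm) (by simp)).symm
      _ = B i := by rw [← Matrix.mul_sum, hBsum, Matrix.mul_one]
  have hpq : ∀ i j, i ≠ j → (p i : ℂ) * p j + q i * star (q j) = 0 ∧
      (p i : ℂ) * q j + q i * p j = 0 := by
    intro i j hij
    have h := hBB i j hij
    have h0 := congrFun (congrFun h 0) 0
    have h1 := congrFun (congrFun h 0) 1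
    rw [hBe i, hBe j, ← hps, ← hps] at h0 h1
    simp [Matrix.mul_apply, Fin.sum_univ_two] at h0 h1
    exact ⟨by simpa using h0, h1⟩
  have hpp : ∀ i, (p i : ℂ) * p i + q i * star (q i) = p i ∧ (2 * p i - 1) * q i = 0 := by
    intro i
    have h := hBid i
    have h0 := congrFun (congrFun h 0) 0
    have h1 := congrFun (congrFun h 0) 1
    rw [hBe i, ← hps] at h0 h1
    simp [Matrix.mul_apply, Fin.sum_univ_two] at h0 h1
    exact ⟨by simpa using h0, by linear_combination h1⟩
  have hhalf : ∀ i j, i ≠ j → B i ≠ 0 → B j ≠ 0 → (p i : ℂ) = 1 / 2 := by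
    intro i j hij hi hj
    have hpi : (p i : ℂ) ≠ 0 := by exact_mod_cast hp0 i hi
    have hpj : (p j : ℂ) ≠ 0 := by exact_mod_cast hp0 j hj
    have hq : q i ≠ 0 := by
      intro h
      have := (hpq i j hij).1
      rw [h] at this
      simp at this
      rcases this with h | h
      · exact hpi (by simp [h])
      · exact hpj (by simp [h])
    have := (hpp i).2
    rcases mul_eq_zero.mp this with h | h
    · linear_combination h / 2
    · exact absurd h hq
  have hqneg : ∀ i j, i ≠ j → B i ≠ 0 → B j ≠ 0 → q j = - q i := by
    intro i j hij hi hj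
    have h1 := hhalf i j hij hi hj
    have h2 := hhalf j i hij.symm hj hi
    have := (hpq i j hij).2
    rw [h1, h2] at this
    linear_combination 2 * this
  have hpi := hhalf i j hij hi hj
  have hpj := hhalf j i hij.symm hj hi
  have hqj := hqneg i j hij hi hj
  have hqn : q i * star (q i) = 1 / 4 := by
    have := (hpp i).1
    rw [hpi] at this
    linear_combination this
  have hnorm : ‖2 * star (q i)‖ = 1 := by
    have h : q i * (starRingEnd ℂ) (q i) = 1 / 4 := hqn
    rw [Complex.mul_conj, Complex.normSq_eq_norm_sq] at h
    have h' : ‖q i‖ ^ 2 = 1 / 4 := by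
      apply Complex.ofReal_injective
      rw [h]; norm_num
    rw [norm_mul, norm_star]
    simp
    nlinarith [norm_nonneg (q i)]
  have hexp : Complex.exp ((2 * star (q i)).arg * Complex.I) = 2 * star (q i) := by
    have := Complex.norm_mul_exp_arg_mul_I (2 * star (q i))
    rw [hnorm] at this
    simpa using this
  refine ⟨(2 * star (q i)).arg, ?_, i, j, hij, ?_, ?_, ?_⟩
  · intro j
    rcases had j with h | h
    · exact ⟨d j, hd j, Or.inr (by rw [hAe j, hb0 j, h]; simp)⟩
    · exact ⟨a j, ha j, Or.inl (by rw [hAe j, hb0 j, h]; simp)⟩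
  · rw [hexp, hBe i, ← hps i, hpi]
    ext m n; fin_cases m <;> fin_cases n <;> simp
  · rw [hexp, hBe j, ← hps j, hpj, hqj]
    ext m n; fin_cases m <;> fin_cases n <;> simp <;> ring
  · intro l hli hlj
    by_contra hl
    have h1 := hqneg l i hli hl hi
    have h2 := hqneg l j hlj hl hj
    have h0 : q i = 0 := by
      rw [h2] at hqj
      rw [h1] at hqj ⊢
      linear_combination hqj / 2
    rw [h0] at hqn
    norm_num at hqn

lemma aux_conj (U : Matrix (Fin 2) (Fin 2) ℂ) (v : Fin 2 → ℂ) :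
    U * vecMulVec v (star v) * Uᴴ = vecMulVec (U *ᵥ v) (star (U *ᵥ v)) := by
  rw [Matrix.mul_vecMulVec, Matrix.vecMulVec_mul, Matrix.star_mulVec]


lemma aux_vec (x y : ℂ) : vecMulVec ![x, y] (star ![x, y]) =
    !![x * star x, x * star y; y * star x, y * star y] := by
  ext m n
  rw [vecMulVec_apply, Pi.star_apply]
  fin_cases m <;> fin_cases n <;> simp

/-- Structure of qubit observables that can be perfectly discriminated in two shots:
if two k-outcome POVMs `A`, `B` on `ℂ²` (with at least two nonzero effects of `B`) admit a
probe state `ρ` with `tr(ρ (A_j ⊗ A_j)) = 0` for all `j` and `tr(ρ (B_i ⊗ B_j)) = 0` for all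
`i ≠ j`, then there is an orthonormal basis `{φ, φ⊥}` and `r ∈ ℝ` such that every `A_j` is a
nonnegative multiple of `|φ⟩⟨φ|` or of `|φ⊥⟩⟨φ⊥|`, and exactly two effects of `B` are nonzero,
equal to `|φ₊⟩⟨φ₊|` and `|φ₋⟩⟨φ₋|` with `φ± = (φ ± e^{ir} φ⊥)/√2`. -/
theorem qubit_two_shot_perfect_discrimination_structure
    (k : ℕ) (A B : Fin k → Matrix (Fin 2) (Fin 2) ℂ)
    (hApos : ∀ j, (A j).PosSemidef) (hAsum : ∑ j, A j = 1)
    (hBpos : ∀ j, (B j).PosSemidef) (hBsum : ∑ j, B j = 1)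
    (hBtwo : ∃ i j, i ≠ j ∧ B i ≠ 0 ∧ B j ≠ 0)
    (ρ : Matrix (Fin 2 × Fin 2) (Fin 2 × Fin 2) ℂ)
    (hρ : ρ.PosSemidef) (hρtr : ρ.trace = 1)
    (hA : ∀ j, (ρ * (A j ⊗ₖ A j)).trace = 0)
    (hB : ∀ i j, i ≠ j → (ρ * (B i ⊗ₖ B j)).trace = 0) :
    ∃ (φ φperp : Fin 2 → ℂ) (r : ℝ),
      star φ ⬝ᵥ φ = 1 ∧ star φperp ⬝ᵥ φperp = 1 ∧ star φ ⬝ᵥ φperp = 0 ∧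
      (∀ j, ∃ t : ℝ, 0 ≤ t ∧
        (A j = (t : ℂ) • Matrix.vecMulVec φ (star φ) ∨
         A j = (t : ℂ) • Matrix.vecMulVec φperp (star φperp))) ∧
      (∃ i j, i ≠ j ∧
        B i = Matrix.vecMulVec
            (((Real.sqrt 2 : ℂ))⁻¹ • (φ + Complex.exp (r * Complex.I) • φperp))
            (star (((Real.sqrt 2 : ℂ))⁻¹ • (φ + Complex.exp (r * Complex.I) • φperp))) ∧
        B j = Matrix.vecMulVec
            (((Real.sqrt 2 : ℂ))⁻¹ • (φ - Complex.exp (r * Complex.I) • φperp))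
            (star (((Real.sqrt 2 : ℂ))⁻¹ • (φ - Complex.exp (r * Complex.I) • φperp))) ∧
        (∀ l, l ≠ i → l ≠ j → B l = 0)) := by
  have hX : ∃ x : Fin 2 × Fin 2, ∃ y, ρ x y ≠ 0 := by
    by_contra! h
    have : ρ = 0 := by ext x y; exact h x y
    rw [this] at hρtr
    simp at hρtr
  obtain ⟨⟨x1, x2⟩, y, hxy⟩ := hX
  set X : Matrix (Fin 2) (Fin 2) ℂ := Matrix.of fun i j => ρ (i, j) y with hXdef
  have hX0 : X ≠ 0 := fun h => hxy (by simpa [hXdef] using congrFun (congrFun h x1) x2)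
  have hAX : ∀ j, A j * X * (A j)ᵀ = 0 := fun j =>
    aux_kron ρ hρ (A j) (A j) (hApos j) (hApos j) (hA j) y
  have hBX : ∀ i j, i ≠ j → B i * X * (B j)ᵀ = 0 := fun i j hij =>
    aux_kron ρ hρ (B i) (B j) (hBpos i) (hBpos j) (hB i j hij) y
  have hj0 : ∃ j, A j ≠ 0 := by
    by_contra! h
    simp [h] at hAsum
  obtain ⟨j0, hj0⟩ := hj0
  obtain ⟨U, hU1, hU2, h00, h01⟩ := aux_unitary (A j0) (hApos j0).1 hj0
  have hU3 : Uᴴᵀ * Uᵀ = 1 := by rw [← Matrix.transpose_mul, hU1, Matrix.transpose_one]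
  have hU4 : Uᵀ * Uᴴᵀ = 1 := by rw [← Matrix.transpose_mul, hU2, Matrix.transpose_one]
  have hback : ∀ M : Matrix (Fin 2) (Fin 2) ℂ, U * (Uᴴ * M * U) * Uᴴ = M := by
    intro M
    calc U * (Uᴴ * M * U) * Uᴴ = (U * Uᴴ) * M * (U * Uᴴ) := by simp only [Matrix.mul_assoc]
      _ = M := by simp [hU1]
  have hconj : ∀ M N : Matrix (Fin 2) (Fin 2) ℂ, M * X * Nᵀ = 0 →
      (Uᴴ * M * U) * (Uᴴ * X * Uᴴᵀ) * (Uᴴ * N * U)ᵀ = 0 := by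
    intro M N h
    rw [Matrix.transpose_mul, Matrix.transpose_mul]
    calc (Uᴴ * M * U) * (Uᴴ * X * Uᴴᵀ) * (Uᵀ * (Nᵀ * Uᴴᵀ))
        = Uᴴ * M * (U * Uᴴ) * X * (Uᴴᵀ * Uᵀ) * Nᵀ * Uᴴᵀ := by simp only [Matrix.mul_assoc]
      _ = Uᴴ * (M * X * Nᵀ) * Uᴴᵀ := by
        rw [hU1, hU3]; simp only [Matrix.mul_assoc, Matrix.mul_one, Matrix.one_mul]
      _ = 0 := by simp [h]
  have hne : ∀ M : Matrix (Fin 2) (Fin 2) ℂ, M ≠ 0 → Uᴴ * M * U ≠ 0 := by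
    intro M hM h
    apply hM
    rw [← hback M, h]; simp
  have hsum : ∀ C : Fin k → Matrix (Fin 2) (Fin 2) ℂ, ∑ j, C j = 1 →
      ∑ j, Uᴴ * C j * U = 1 := by
    intro C hC
    rw [← Matrix.sum_mul, ← Matrix.mul_sum, hC, Matrix.mul_one, hU2]
  obtain ⟨i1, i2, hi12, hi1, hi2⟩ := hBtwo
  obtain ⟨r, hAr, i, j, hij, hBi, hBj, hBl⟩ :=
    aux_core k (fun j => Uᴴ * A j * U) (fun j => Uᴴ * B j * U)
      (fun j => (hApos j).conjTranspose_mul_mul_same U) (hsum A hAsum)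
      (fun j => (hBpos j).conjTranspose_mul_mul_same U) (hsum B hBsum)
      ⟨i1, i2, hi12, hne _ hi1, hne _ hi2⟩ (Uᴴ * X * Uᴴᵀ)
      (by
        intro h
        apply hX0
        calc X = (U * Uᴴ) * X * (Uᴴᵀ * Uᵀ) := by simp [hU1, hU3]
          _ = U * (Uᴴ * X * Uᴴᵀ) * Uᵀ := by simp only [Matrix.mul_assoc]
          _ = 0 := by simp [h])
      (fun j => hconj _ _ (hAX j)) (fun i j hij => hconj _ _ (hBX i j hij)) j0 h00 h01
  have hdot : ∀ v w : Fin 2 → ℂ, star (U *ᵥ v) ⬝ᵥ (U *ᵥ w) = star v ⬝ᵥ w := by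
    intro v w
    rw [Matrix.star_mulVec, Matrix.dotProduct_mulVec, Matrix.vecMul_vecMul, hU2, Matrix.vecMul_one]
  have hsq : ((Real.sqrt 2 : ℂ))⁻¹ * ((Real.sqrt 2 : ℂ))⁻¹ = 1 / 2 := by
    rw [← mul_inv, ← Complex.ofReal_mul, Real.mul_self_sqrt (by norm_num)]
    norm_num
  have hee : Complex.exp (r * Complex.I) * star (Complex.exp (r * Complex.I)) = 1 := by
    have := Complex.mul_conj (Complex.exp (r * Complex.I))
    rw [Complex.normSq_eq_norm_sq, Complex.norm_exp_ofReal_mul_I] at this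
    simpa using this
  have hcs : star ((Real.sqrt 2 : ℂ))⁻¹ = ((Real.sqrt 2 : ℂ))⁻¹ := by simp
  generalize ((Real.sqrt 2 : ℂ))⁻¹ = c at *
  generalize hE : Complex.exp (r * Complex.I) = e at *
  refine ⟨U *ᵥ ![1, 0], U *ᵥ ![0, 1], r, ?_, ?_, ?_, ?_, i, j, hij, ?_, ?_, ?_⟩
  · rw [hdot]; simp [dotProduct, Fin.sum_univ_two]
  · rw [hdot]; simp [dotProduct, Fin.sum_univ_two]
  · rw [hdot]; simp [dotProduct, Fin.sum_univ_two]
  · intro j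
    obtain ⟨t, ht, h⟩ := hAr j
    refine ⟨t, ht, ?_⟩
    rcases h with h | h
    · left
      rw [← hback (A j), h, ← aux_conj, ← Matrix.smul_mul, ← Matrix.mul_smul, aux_vec]
      congr 2
      ext m n; fin_cases m <;> fin_cases n <;> simp
    · right
      rw [← hback (A j), h, ← aux_conj, ← Matrix.smul_mul, ← Matrix.mul_smul, aux_vec]
      congr 2
      ext m n; fin_cases m <;> fin_cases n <;> simp
  · rw [hE, ← hback (B i), hBi, ← Matrix.mulVec_smul, ← Matrix.mulVec_add, ← Matrix.mulVec_smul,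
      ← aux_conj,
      show c • (![1, 0] + e • ![0, 1]) = ![c, c * e] by
        ext m; fin_cases m <;> simp, aux_vec]
    congr 2
    ext m n
    fin_cases m <;> fin_cases n <;> simp <;> simp at hcs hee <;> rw [hcs]
    · linear_combination -hsq
    · linear_combination -(starRingEnd ℂ) e * hsq
    · linear_combination -e * hsq
    · linear_combination -hsq - c * c * hee
  · rw [hE, ← hback (B j), hBj, ← Matrix.mulVec_smul, ← Matrix.mulVec_sub, ← Matrix.mulVec_smul,
      ← aux_conj,
      show c • (![1, 0] - e • ![0, 1]) = ![c, -(c * e)] by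
        ext m; fin_cases m <;> simp, aux_vec]
    congr 2
    ext m n
    fin_cases m <;> fin_cases n <;> simp <;> simp at hcs hee <;> rw [hcs]
    · linear_combination -hsq
    · linear_combination (starRingEnd ℂ) e * hsq
    · linear_combination e * hsq
    · linear_combination -hsq - c * c * hee
  · intro l h1 h2
    rw [← hback (B l), hBl l h1 h2]; simp
end

section
/- Let a, b ∈ ℝ³ be unit vectors with a × b ≠ 0, let A, B be the sharp qubit observables associated with a and b, and let η, P ∈ ℝ. Then the following are equivalent: (i) there exists a unit vector ψ ∈ ℂ² ⊗ ℂ² with ⟨ψ, (B₁⊗B₁ + B₂⊗B₂) ψ⟩ = 0 and η·⟨ψ, (A₁⊗A₁ + A₂⊗A₂) ψ⟩ = P; (ii) there exists a unit vector ψ′ ∈ ℂ² ⊗ ℂ² with ⟨ψ′, (B₁⊗B₂ + B₂⊗B₁) ψ′⟩ = 0 and η·⟨ψ′, (A₁⊗A₂ + A₂⊗A₁) ψ′⟩ = P. (That is, for unambiguous identification of a sharp qubit observable with two shots, taking the 'same outcomes' result as conclusive is exactly as good as taking the 'different outcomes' result as conclusive.) -/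
open Matrix Kronecker

/-- The Pauli matrices `σ₁, σ₂, σ₃`. -/
noncomputable def pauli : Fin 3 → Matrix (Fin 2) (Fin 2) ℂ :=
  ![!![0, 1; 1, 0], !![0, -Complex.I; Complex.I, 0], !![1, 0; 0, -1]]

/-- For `a ∈ ℝ³`, the matrix `a·σ = a₁σ₁ + a₂σ₂ + a₃σ₃`. -/
noncomputable def pauliDot (a : Fin 3 → ℝ) : Matrix (Fin 2) (Fin 2) ℂ :=
  ∑ i, (a i : ℂ) • pauli i

/-- The first effect `(I + a·σ)/2` of the qubit observable associated with `a`. -/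
noncomputable def qubitEffect₁ (a : Fin 3 → ℝ) : Matrix (Fin 2) (Fin 2) ℂ :=
  (2 : ℂ)⁻¹ • (1 + pauliDot a)

/-- The second effect `(I − a·σ)/2` of the qubit observable associated with `a`. -/
noncomputable def qubitEffect₂ (a : Fin 3 → ℝ) : Matrix (Fin 2) (Fin 2) ℂ :=
  (2 : ℂ)⁻¹ • (1 - pauliDot a)

lemma pauliDot_herm (n : Fin 3 → ℝ) : (pauliDot n)ᴴ = pauliDot n := by
  ext i j
  fin_cases i <;> fin_cases j <;>
    simp [pauliDot, pauli, Fin.sum_univ_three, Matrix.conjTranspose_apply]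

lemma pauliDot_anti (n a : Fin 3 → ℝ) (h : n 0 * a 0 + n 1 * a 1 + n 2 * a 2 = 0) :
    pauliDot n * pauliDot a = - (pauliDot a * pauliDot n) := by
  have h' : (n 0 : ℂ) * a 0 + n 1 * a 1 + n 2 * a 2 = 0 := by exact_mod_cast h
  have hI := Complex.I_mul_I
  ext i j
  fin_cases i <;> fin_cases j <;>
    simp [pauliDot, pauli, Fin.sum_univ_three, Matrix.mul_apply] <;>
    first
      | ring1
      | linear_combination 2 * h' - 2 * (n 1 : ℂ) * a 1 * hI

lemma pauliDot_sq (n : Fin 3 → ℝ) (h : n 0 ^ 2 + n 1 ^ 2 + n 2 ^ 2 = 1) :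
    pauliDot n * pauliDot n = 1 := by
  have h' : (n 0 : ℂ) ^ 2 + n 1 ^ 2 + n 2 ^ 2 = 1 := by exact_mod_cast h
  have hI := Complex.I_mul_I
  ext i j
  fin_cases i <;> fin_cases j <;>
    simp [pauliDot, pauli, Fin.sum_univ_three, Matrix.mul_apply] <;>
    first
      | ring1
      | linear_combination h' - (n 1 : ℂ) ^ 2 * hI

lemma effect_swap (n a : Fin 3 → ℝ) (hn : n 0 ^ 2 + n 1 ^ 2 + n 2 ^ 2 = 1)
    (h : n 0 * a 0 + n 1 * a 1 + n 2 * a 2 = 0) :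
    pauliDot n * qubitEffect₁ a * pauliDot n = qubitEffect₂ a ∧
    pauliDot n * qubitEffect₂ a * pauliDot n = qubitEffect₁ a := by
  have h1 := pauliDot_anti n a h
  have h2 := pauliDot_sq n hn
  have h3 : pauliDot n * pauliDot a * pauliDot n = - pauliDot a := by
    rw [h1, Matrix.neg_mul, Matrix.mul_assoc, h2, Matrix.mul_one]
  constructor
  · simp [qubitEffect₁, qubitEffect₂, mul_add, add_mul, h2, h3, sub_eq_add_neg]
  · simp [qubitEffect₁, qubitEffect₂, mul_sub, sub_mul, h2, h3]

lemma exists_normal (a b : Fin 3 → ℝ) (hab : crossProduct a b ≠ 0) :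
    ∃ n : Fin 3 → ℝ, n 0 ^ 2 + n 1 ^ 2 + n 2 ^ 2 = 1 ∧
      n 0 * a 0 + n 1 * a 1 + n 2 * a 2 = 0 ∧ n 0 * b 0 + n 1 * b 1 + n 2 * b 2 = 0 := by
  set c := crossProduct a b with hc
  have hca : c 0 * a 0 + c 1 * a 1 + c 2 * a 2 = 0 := by
    simp [hc, cross_apply]; ring
  have hcb : c 0 * b 0 + c 1 * b 1 + c 2 * b 2 = 0 := by
    simp [hc, cross_apply]; ring
  clear_value c
  have hpos : 0 < c 0 ^ 2 + c 1 ^ 2 + c 2 ^ 2 := by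
    by_contra hlt
    apply hab
    have h0 : c 0 = 0 := by nlinarith [sq_nonneg (c 0), sq_nonneg (c 1), sq_nonneg (c 2)]
    have h1 : c 1 = 0 := by nlinarith [sq_nonneg (c 0), sq_nonneg (c 1), sq_nonneg (c 2)]
    have h2 : c 2 = 0 := by nlinarith [sq_nonneg (c 0), sq_nonneg (c 1), sq_nonneg (c 2)]
    ext i
    fin_cases i <;> simp [h0, h1, h2]
  set r := Real.sqrt (c 0 ^ 2 + c 1 ^ 2 + c 2 ^ 2) with hr
  have hr0 : r ≠ 0 := (Real.sqrt_pos.mpr hpos).ne'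
  have hr2 : r ^ 2 = c 0 ^ 2 + c 1 ^ 2 + c 2 ^ 2 := Real.sq_sqrt hpos.le
  refine ⟨fun i => c i / r, ?_, ?_, ?_⟩
  · field_simp
    linarith
  · field_simp
    linarith
  · field_simp
    linarith

lemma transform (N : Matrix (Fin 2) (Fin 2) ℂ) (hN : Nᴴ = N)
    (M : Matrix (Fin 2 × Fin 2) (Fin 2 × Fin 2) ℂ) (ψ : Fin 2 × Fin 2 → ℂ) :
    star ((N ⊗ₖ (1 : Matrix (Fin 2) (Fin 2) ℂ)) *ᵥ ψ) ⬝ᵥ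
        M *ᵥ ((N ⊗ₖ (1 : Matrix (Fin 2) (Fin 2) ℂ)) *ᵥ ψ) =
      star ψ ⬝ᵥ ((N ⊗ₖ (1 : Matrix (Fin 2) (Fin 2) ℂ)) * M *
        (N ⊗ₖ (1 : Matrix (Fin 2) (Fin 2) ℂ))) *ᵥ ψ := by
  rw [Matrix.star_mulVec, Matrix.conjTranspose_kronecker, hN, Matrix.conjTranspose_one,
    ← Matrix.dotProduct_mulVec, Matrix.mulVec_mulVec, Matrix.mulVec_mulVec]

lemma conj_kron (N X Y Z W X' Z' : Matrix (Fin 2) (Fin 2) ℂ)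
    (h : N * X * N = X') (h' : N * Z * N = Z') :
    (N ⊗ₖ (1 : Matrix (Fin 2) (Fin 2) ℂ)) * (X ⊗ₖ Y + Z ⊗ₖ W) *
        (N ⊗ₖ (1 : Matrix (Fin 2) (Fin 2) ℂ)) = X' ⊗ₖ Y + Z' ⊗ₖ W := by
  rw [mul_add, add_mul]
  simp only [← Matrix.mul_kronecker_mul, Matrix.one_mul, Matrix.mul_one, h, h']

/-- For two-shot unambiguous identification of the sharp qubit observable `A` (associated to
`a`) against `B` (associated to `b`), taking the "same outcomes" result as conclusive is
exactly as good as taking the "different outcomes" result as conclusive. -/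
theorem same_conclusive_iff_diff_conclusive
    (a b : Fin 3 → ℝ)
    (ha : ∑ i, a i ^ 2 = 1) (hb : ∑ i, b i ^ 2 = 1)
    (hab : crossProduct a b ≠ 0) (η P : ℝ) :
    (∃ ψ : Fin 2 × Fin 2 → ℂ, star ψ ⬝ᵥ ψ = 1 ∧
      star ψ ⬝ᵥ (qubitEffect₁ b ⊗ₖ qubitEffect₁ b + qubitEffect₂ b ⊗ₖ qubitEffect₂ b) *ᵥ ψ
        = 0 ∧
      (η : ℂ) *
        (star ψ ⬝ᵥ (qubitEffect₁ a ⊗ₖ qubitEffect₁ a + qubitEffect₂ a ⊗ₖ qubitEffect₂ a) *ᵥ ψ)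
        = (P : ℂ)) ↔
    (∃ ψ' : Fin 2 × Fin 2 → ℂ, star ψ' ⬝ᵥ ψ' = 1 ∧
      star ψ' ⬝ᵥ (qubitEffect₁ b ⊗ₖ qubitEffect₂ b + qubitEffect₂ b ⊗ₖ qubitEffect₁ b) *ᵥ ψ'
        = 0 ∧
      (η : ℂ) *
        (star ψ' ⬝ᵥ (qubitEffect₁ a ⊗ₖ qubitEffect₂ a + qubitEffect₂ a ⊗ₖ qubitEffect₁ a) *ᵥ ψ')
        = (P : ℂ)) := by
  obtain ⟨n, hn, hna, hnb⟩ := exists_normal a b hab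
  obtain ⟨a1, a2⟩ := effect_swap n a hn hna
  obtain ⟨b1, b2⟩ := effect_swap n b hn hnb
  have hH := pauliDot_herm n
  have hS := pauliDot_sq n hn
  have hnorm : ∀ ψ : Fin 2 × Fin 2 → ℂ, star ψ ⬝ᵥ ψ = 1 →
      star ((pauliDot n ⊗ₖ (1 : Matrix (Fin 2) (Fin 2) ℂ)) *ᵥ ψ) ⬝ᵥ
        ((pauliDot n ⊗ₖ (1 : Matrix (Fin 2) (Fin 2) ℂ)) *ᵥ ψ) = 1 := by
    intro ψ h
    have := transform (pauliDot n) hH 1 ψ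
    rw [Matrix.one_mulVec, Matrix.mul_one, ← Matrix.mul_kronecker_mul, hS, Matrix.one_mul,
      Matrix.one_kronecker_one, Matrix.one_mulVec, h] at this
    exact this
  constructor
  · rintro ⟨ψ, h1, h2, h3⟩
    refine ⟨_, hnorm ψ h1, ?_, ?_⟩
    · rw [transform _ hH, conj_kron _ _ _ _ _ _ _ b1 b2, add_comm]
      exact h2
    · rw [transform _ hH, conj_kron _ _ _ _ _ _ _ a1 a2, add_comm]
      exact h3
  · rintro ⟨ψ, h1, h2, h3⟩
    refine ⟨_, hnorm ψ h1, ?_, ?_⟩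
    · rw [transform _ hH, conj_kron _ _ _ _ _ _ _ b1 b2, add_comm]
      exact h2
    · rw [transform _ hH, conj_kron _ _ _ _ _ _ _ a1 a2, add_comm]
      exact h3
end

section
/- Let a, b ∈ ℝ³ be unit vectors and let A, B be the sharp qubit observables associated with a and b. Then the supremum, over all unit vectors ψ ∈ ℂ² ⊗ ℂ² satisfying ⟨ψ, (B₁⊗B₁ + B₂⊗B₂) ψ⟩ = 0, of the quantity ⟨ψ, (A₁⊗A₁ + A₂⊗A₂) ψ⟩ equals 1 − (a·b)² (= sin²θ_{ab}), and it is attained by ψ = (φ ⊗ φ⊥ + φ⊥ ⊗ φ)/√2, where {φ, φ⊥} is an orthonormal basis of ℂ² with B₁φ = φ and B₂φ⊥ = φ⊥. (Hence with a priori probability η for A, the optimal success probability of unambiguously identifying A in two shots is η·sin²θ_{ab}.) -/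
open Matrix Kronecker

/-- Pauli coordinate vector of `ψ σ₂`. -/
noncomputable def nvec (ψ : Fin 2 × Fin 2 → ℂ) : Fin 3 → ℂ :=
  ![Complex.I * (ψ (1,1) - ψ (0,0)) / 2, (ψ (1,1) + ψ (0,0)) / 2,
    Complex.I * (ψ (0,1) + ψ (1,0)) / 2]

lemma norm_formula (ψ : Fin 2 × Fin 2 → ℂ) :
    star ψ ⬝ᵥ ψ = (((Complex.normSq (ψ (0,1) - ψ (1,0))) / 2
      + 2 * ∑ i, Complex.normSq (nvec ψ i) : ℝ) : ℂ) := by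
  simp only [dotProduct, Fintype.sum_prod_type, Fin.sum_univ_two, Fin.sum_univ_three, nvec,
    Pi.star_apply]
  apply Complex.ext
  · rw [Complex.ofReal_re]
    simp [Complex.normSq_apply]
    ring
  · rw [Complex.ofReal_im]
    simp
    ring

lemma effect_formula (a : Fin 3 → ℝ) (ha : ∑ i, a i ^ 2 = 1) (ψ : Fin 2 × Fin 2 → ℂ) :
    star ψ ⬝ᵥ (qubitEffect₁ a ⊗ₖ qubitEffect₁ a + qubitEffect₂ a ⊗ₖ qubitEffect₂ a) *ᵥ ψ
      = ((2 * (∑ i, Complex.normSq (nvec ψ i)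
          - Complex.normSq (∑ i, (a i : ℂ) * nvec ψ i)) : ℝ) : ℂ) := by
  rw [Fin.sum_univ_three] at ha
  obtain ⟨x, hx⟩ : ∃ x, x = a 0 := ⟨_, rfl⟩
  obtain ⟨y, hy⟩ : ∃ y, y = a 1 := ⟨_, rfl⟩
  obtain ⟨z, hz⟩ : ∃ z, z = a 2 := ⟨_, rfl⟩
  obtain ⟨p, hp⟩ : ∃ x, x = ψ (0,0) := ⟨_, rfl⟩
  obtain ⟨q, hq⟩ : ∃ x, x = ψ (0,1) := ⟨_, rfl⟩
  obtain ⟨r, hr⟩ : ∃ x, x = ψ (1,0) := ⟨_, rfl⟩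
  obtain ⟨s, hs⟩ : ∃ x, x = ψ (1,1) := ⟨_, rfl⟩
  simp only [dotProduct, mulVec, Fintype.sum_prod_type, Fin.sum_univ_two, Fin.sum_univ_three, nvec,
    Pi.star_apply, qubitEffect₁, qubitEffect₂, pauliDot, pauli, Matrix.add_apply, kroneckerMap_apply,
    Matrix.smul_apply, Matrix.sub_apply, ← hx, ← hy, ← hz, ← hp, ← hq, ← hr, ← hs] at ha ⊢
  apply Complex.ext
  · rw [Complex.ofReal_re]
    simp [Complex.normSq_apply]
    linear_combination ((p.re ^ 2 + p.im ^ 2 + s.re ^ 2 + s.im ^ 2) / 2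
      + q.re * r.re + q.im * r.im) * ha
  · rw [Complex.ofReal_im]
    simp
    ring

lemma normSq_sub_formula (b : Fin 3 → ℝ) (hb : ∑ i, b i ^ 2 = 1) (n : Fin 3 → ℂ)
    (h : ∑ i, Complex.normSq (n i) = Complex.normSq (∑ i, (b i : ℂ) * n i)) (i : Fin 3) :
    n i = (∑ i, (b i : ℂ) * n i) * b i := by
  obtain ⟨c, hc⟩ : ∃ c, c = ∑ i, (b i : ℂ) * n i := ⟨_, rfl⟩
  have key : ∑ i, Complex.normSq (n i - c * b i) = 0 := by
    have e : ∑ i, Complex.normSq (n i - c * b i) = ∑ i, Complex.normSq (n i)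
        - Complex.normSq c * (2 - ∑ i, b i ^ 2) := by
      rw [hc]
      simp [Complex.normSq_apply, Fin.sum_univ_three]
      ring
    rw [e, h, hb, ← hc]; ring
  have := (Finset.sum_eq_zero_iff_of_nonneg (fun i _ => Complex.normSq_nonneg _)).1 key i
    (Finset.mem_univ i)
  rw [← hc]
  exact sub_eq_zero.1 (Complex.normSq_eq_zero.1 this)

lemma effect_of_zero (a b : Fin 3 → ℝ) (ha : ∑ i, a i ^ 2 = 1) (hb : ∑ i, b i ^ 2 = 1)
    (ψ : Fin 2 × Fin 2 → ℂ)
    (h : star ψ ⬝ᵥ (qubitEffect₁ b ⊗ₖ qubitEffect₁ b + qubitEffect₂ b ⊗ₖ qubitEffect₂ b) *ᵥ ψ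
      = 0) :
    star ψ ⬝ᵥ (qubitEffect₁ a ⊗ₖ qubitEffect₁ a + qubitEffect₂ a ⊗ₖ qubitEffect₂ a) *ᵥ ψ
      = ((2 * (∑ i, Complex.normSq (nvec ψ i)) * (1 - (∑ i, a i * b i) ^ 2) : ℝ) : ℂ) := by
  rw [effect_formula b hb] at h
  rw [effect_formula a ha]
  have h' := Complex.ofReal_eq_zero.1 h
  have h2 : ∑ i, Complex.normSq (nvec ψ i) = Complex.normSq (∑ i, (b i : ℂ) * nvec ψ i) := by
    linarith
  have h3 := normSq_sub_formula b hb _ h2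
  obtain ⟨c, hc⟩ : ∃ c, c = ∑ i, (b i : ℂ) * nvec ψ i := ⟨_, rfl⟩
  rw [← hc] at h2 h3
  have h4 : ∑ i, (a i : ℂ) * nvec ψ i = c * ((∑ i, a i * b i : ℝ) : ℂ) := by
    push_cast
    rw [Finset.mul_sum]
    refine Finset.sum_congr rfl fun i _ => ?_
    rw [h3 i]; ring
  rw [h4, h2, Complex.normSq_mul, Complex.normSq_ofReal]
  congr 1; ring

lemma kron_tensor (A B : Matrix (Fin 2) (Fin 2) ℂ) (φ χ : Fin 2 → ℂ) :
    (A ⊗ₖ B) *ᵥ tensorC2 φ χ = tensorC2 (A *ᵥ φ) (B *ᵥ χ) := by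
  ext ⟨i, j⟩
  simp only [mulVec, dotProduct, Fintype.sum_prod_type, Fin.sum_univ_two, kroneckerMap_apply,
    tensorC2]
  ring

lemma dot_le (a b : Fin 3 → ℝ) (ha : ∑ i, a i ^ 2 = 1) (hb : ∑ i, b i ^ 2 = 1) :
    0 ≤ 1 - (∑ i, a i * b i) ^ 2 := by
  have := Finset.sum_mul_sq_le_sq_mul_sq Finset.univ a b
  rw [ha, hb] at this
  linarith

/-- Optimal two-shot unambiguous identification of a sharp qubit observable `A` against `B`:
over all unit probe states annihilating `B₁⊗B₁ + B₂⊗B₂`, the maximal value of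
`⟨ψ, (A₁⊗A₁ + A₂⊗A₂)ψ⟩` is `sin²θ_{ab} = 1 − (a·b)²`, attained by the probe state
`(φ ⊗ φ⊥ + φ⊥ ⊗ φ)/√2` built from the eigenbasis of `B`. -/
theorem optimal_two_shot_identification_sharp
    (a b : Fin 3 → ℝ)
    (ha : ∑ i, a i ^ 2 = 1) (hb : ∑ i, b i ^ 2 = 1) :
    IsGreatest {x : ℝ | ∃ ψ : Fin 2 × Fin 2 → ℂ, star ψ ⬝ᵥ ψ = 1 ∧
        star ψ ⬝ᵥ (qubitEffect₁ b ⊗ₖ qubitEffect₁ b + qubitEffect₂ b ⊗ₖ qubitEffect₂ b) *ᵥ ψ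
          = 0 ∧
        star ψ ⬝ᵥ (qubitEffect₁ a ⊗ₖ qubitEffect₁ a + qubitEffect₂ a ⊗ₖ qubitEffect₂ a) *ᵥ ψ
          = (x : ℂ)}
      (1 - (∑ i, a i * b i) ^ 2) ∧
    ∀ φ φperp : Fin 2 → ℂ,
      star φ ⬝ᵥ φ = 1 → star φperp ⬝ᵥ φperp = 1 → star φ ⬝ᵥ φperp = 0 →
      qubitEffect₁ b *ᵥ φ = φ → qubitEffect₂ b *ᵥ φperp = φperp →
      ∀ ψ : Fin 2 × Fin 2 → ℂ,
        ψ = ((Real.sqrt 2 : ℂ))⁻¹ • (tensorC2 φ φperp + tensorC2 φperp φ) →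
        star ψ ⬝ᵥ ψ = 1 ∧
        star ψ ⬝ᵥ (qubitEffect₁ b ⊗ₖ qubitEffect₁ b + qubitEffect₂ b ⊗ₖ qubitEffect₂ b) *ᵥ ψ
          = 0 ∧
        star ψ ⬝ᵥ (qubitEffect₁ a ⊗ₖ qubitEffect₁ a + qubitEffect₂ a ⊗ₖ qubitEffect₂ a) *ᵥ ψ
          = ((1 - (∑ i, a i * b i) ^ 2 : ℝ) : ℂ) := by
  refine ⟨⟨?_, ?_⟩, ?_⟩
  · let ψ : Fin 2 × Fin 2 → ℂ := fun p => ((Real.sqrt 2)⁻¹ : ℝ) *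
      (!![(b 1 + Complex.I * b 0 : ℂ), -Complex.I * b 2; -Complex.I * b 2, b 1 - Complex.I * b 0]
        p.1 p.2)
    have hn : ∀ i, nvec ψ i = ((Real.sqrt 2)⁻¹ : ℝ) * (b i : ℂ) := by
      intro i
      fin_cases i <;> simp [nvec, ψ] <;> ring_nf <;> simp
    have hs : (Real.sqrt 2)⁻¹ * (Real.sqrt 2)⁻¹ = 1 / 2 := by
      rw [← mul_inv, Real.mul_self_sqrt (by norm_num)]; norm_num
    have hN : ∑ i, Complex.normSq (nvec ψ i) = 1 / 2 := by
      simp only [hn, Complex.normSq_mul, Complex.normSq_ofReal, hs, ← Finset.mul_sum, ← pow_two, hb]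
      norm_num
    have h0 : star ψ ⬝ᵥ (qubitEffect₁ b ⊗ₖ qubitEffect₁ b + qubitEffect₂ b ⊗ₖ qubitEffect₂ b) *ᵥ ψ
          = 0 := by
      rw [effect_formula b hb, hN]
      have : ∑ i, (b i : ℂ) * nvec ψ i = (((Real.sqrt 2)⁻¹ * ∑ i, b i ^ 2 : ℝ) : ℂ) := by
        rw [Finset.mul_sum, Complex.ofReal_sum]
        refine Finset.sum_congr rfl fun i _ => ?_
        rw [hn]; push_cast; ring
      rw [this, hb, Complex.normSq_ofReal, mul_one, hs]
      simp
    refine ⟨ψ, ?_, h0, ?_⟩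
    · rw [norm_formula, hN]
      simp [ψ]
    · rw [effect_of_zero a b ha hb ψ h0, hN]
      congr 1; ring
  · rintro x ⟨ψ, h1, h0, hx⟩
    rw [effect_of_zero a b ha hb ψ h0] at hx
    have hx' := Complex.ofReal_inj.1 hx
    rw [norm_formula] at h1
    have h1' := Complex.ofReal_eq_one.1 h1
    have := Complex.normSq_nonneg (ψ (0,1) - ψ (1,0))
    have hd := dot_le a b ha hb
    rw [← hx']
    exact mul_le_of_le_one_left hd (by linarith)
  · intro φ χ h1 h2 h3 h4 h5 ψ hψ
    have hsum : qubitEffect₁ b + qubitEffect₂ b = 1 := by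
      simp only [qubitEffect₁, qubitEffect₂]
      ext i j
      simp; ring
    have hb1 : qubitEffect₁ b *ᵥ χ = 0 := by
      have := congrArg (· *ᵥ χ) hsum
      simpa only [add_mulVec, h5, one_mulVec, add_eq_right] using this
    have hb2 : qubitEffect₂ b *ᵥ φ = 0 := by
      have := congrArg (· *ᵥ φ) hsum
      simpa only [add_mulVec, h4, one_mulVec, add_eq_left] using this
    have hs : ((Real.sqrt 2 : ℂ))⁻¹ * ((Real.sqrt 2 : ℂ))⁻¹ = 1 / 2 := by
      rw [← mul_inv, ← Complex.ofReal_mul, Real.mul_self_sqrt (by norm_num)]; norm_num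
    have hn : star ψ ⬝ᵥ ψ = 1 := by
      have : star ψ ⬝ᵥ ψ = ((Real.sqrt 2 : ℂ))⁻¹ * ((Real.sqrt 2 : ℂ))⁻¹ *
          (2 * (star φ ⬝ᵥ φ) * (star χ ⬝ᵥ χ) + 2 * (star φ ⬝ᵥ χ) * (star χ ⬝ᵥ φ)) := by
        rw [hψ]
        simp [dotProduct, Fintype.sum_prod_type, tensorC2]
        ring
      rw [this, hs, h1, h2, h3]; norm_num
    have h0 : star ψ ⬝ᵥ (qubitEffect₁ b ⊗ₖ qubitEffect₁ b + qubitEffect₂ b ⊗ₖ qubitEffect₂ b) *ᵥ ψ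
          = 0 := by
      have : (qubitEffect₁ b ⊗ₖ qubitEffect₁ b + qubitEffect₂ b ⊗ₖ qubitEffect₂ b) *ᵥ ψ = 0 := by
        rw [hψ, mulVec_smul, add_mulVec, mulVec_add, mulVec_add]
        simp only [kron_tensor, hb1, hb2]
        ext p
        simp [tensorC2]
      rw [this, dotProduct_zero]
    refine ⟨hn, h0, ?_⟩
    rw [effect_of_zero a b ha hb ψ h0]
    rw [norm_formula] at hn
    have hn' := Complex.ofReal_eq_one.1 hn
    have hsym : ψ (0,1) - ψ (1,0) = 0 := by
      rw [hψ]; simp [tensorC2]; ring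
    rw [hsym, Complex.normSq_zero, zero_div, zero_add] at hn'
    rw [hn', one_mul]
end

section
/- Let a ∈ ℝ³ with 0 < ‖a‖ ≤ 1 and let b ∈ ℝ³ be a unit vector. Define the (possibly unsharp) qubit observable A₁ = (I + a·σ)/2, A₂ = (I − a·σ)/2, and let B be the sharp qubit observable associated with b. Then the supremum, over all unit vectors ψ ∈ ℂ² ⊗ ℂ² satisfying ⟨ψ, (B₁⊗B₁ + B₂⊗B₂) ψ⟩ = 0, of ⟨ψ, (A₁⊗A₁ + A₂⊗A₂) ψ⟩ equals ‖a × b‖² + (1 − ‖a‖²)/2, and it is attained by ψ = (φ ⊗ φ⊥ + φ⊥ ⊗ φ)/√2 where {φ, φ⊥} is an orthonormal basis of ℂ² with B₁φ = φ and B₂φ⊥ = φ⊥. In particular this value is nonzero whenever a ≠ b and a ≠ −b or ‖a‖ < 1, so an unsharp qubit observable can be unambiguously identified even though it cannot be unambiguously discriminated. -/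
open Matrix Kronecker

theorem pd_anti (x y : Fin 3 → ℝ) :
    pauliDot x * pauliDot y + pauliDot y * pauliDot x
      = (((2 * ∑ i, x i * y i : ℝ)) : ℂ) • (1 : Matrix (Fin 2) (Fin 2) ℂ) := by
  have hI := Complex.I_sq
  ext i j
  fin_cases i <;> fin_cases j <;>
    simp [pauliDot, pauli, Fin.sum_univ_three, Matrix.mul_apply, Fin.sum_univ_two] <;>
    first | ring1 | linear_combination (-2 * (x 1 : ℂ) * y 1) * hI

theorem pd_sq (x : Fin 3 → ℝ) :
    pauliDot x * pauliDot x
      = (((∑ i, x i ^ 2 : ℝ)) : ℂ) • (1 : Matrix (Fin 2) (Fin 2) ℂ) := by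
  have hI := Complex.I_sq
  ext i j
  fin_cases i <;> fin_cases j <;>
    simp [pauliDot, pauli, Fin.sum_univ_three, Matrix.mul_apply, Fin.sum_univ_two] <;>
    first | ring1 | linear_combination (- (x 1 : ℂ) * x 1) * hI

theorem pd_herm (x : Fin 3 → ℝ) : (pauliDot x)ᴴ = pauliDot x := by
  ext i j
  fin_cases i <;> fin_cases j <;>
    simp [pauliDot, pauli, Fin.sum_univ_three, Matrix.conjTranspose_apply]

theorem pd_comb (c : ℝ) (x y : Fin 3 → ℝ) :
    pauliDot (c • x + y) = (c : ℂ) • pauliDot x + pauliDot y := by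
  simp [pauliDot, Finset.smul_sum, ← Finset.sum_add_distrib, add_smul, mul_smul]

theorem eff_eq (x : Fin 3 → ℝ) :
    qubitEffect₁ x ⊗ₖ qubitEffect₁ x + qubitEffect₂ x ⊗ₖ qubitEffect₂ x
      = (2 : ℂ)⁻¹ • (1 + pauliDot x ⊗ₖ pauliDot x) := by
  ext ⟨i, j⟩ ⟨k, l⟩
  simp only [qubitEffect₁, qubitEffect₂, ← one_kronecker_one (α := ℂ) (m := Fin 2) (n := Fin 2),
    Matrix.add_apply, Matrix.smul_apply, Matrix.sub_apply, kronecker_apply, smul_eq_mul]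
  ring

theorem exp_eff (x : Fin 3 → ℝ) (ψ : Fin 2 × Fin 2 → ℂ) (h : star ψ ⬝ᵥ ψ = 1) :
    star ψ ⬝ᵥ (qubitEffect₁ x ⊗ₖ qubitEffect₁ x + qubitEffect₂ x ⊗ₖ qubitEffect₂ x) *ᵥ ψ
      = (1 + star ψ ⬝ᵥ (pauliDot x ⊗ₖ pauliDot x) *ᵥ ψ) / 2 := by
  rw [eff_eq, smul_mulVec, add_mulVec, one_mulVec, dotProduct_smul, dotProduct_add, h, smul_eq_mul]
  ring

theorem herm_move {n : Type*} [Fintype n] (M : Matrix n n ℂ) (hM : Mᴴ = M) (u v : n → ℂ) :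
    star (M *ᵥ u) ⬝ᵥ v = star u ⬝ᵥ M *ᵥ v := by
  rw [star_mulVec, hM, dotProduct_mulVec]

theorem kr_herm (x y : Fin 3 → ℝ) :
    (pauliDot x ⊗ₖ pauliDot y)ᴴ = pauliDot x ⊗ₖ pauliDot y := by
  rw [conjTranspose_kronecker, pd_herm, pd_herm]

theorem kr_sq (x : Fin 3 → ℝ) (v : Fin 2 × Fin 2 → ℂ) :
    (pauliDot x ⊗ₖ pauliDot x) *ᵥ (pauliDot x ⊗ₖ pauliDot x) *ᵥ v
      = (((∑ i, x i ^ 2 : ℝ)) : ℂ) ^ 2 • v := by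
  rw [mulVec_mulVec, ← mul_kronecker_mul, pd_sq, smul_kronecker, kronecker_smul,
    one_kronecker_one, smul_mulVec, smul_mulVec, one_mulVec, smul_smul, sq]

theorem cross_id (a b : Fin 3 → ℝ) (hb : ∑ i, b i ^ 2 = 1) :
    ∑ i, (crossProduct a b) i ^ 2 = ∑ i, a i ^ 2 - (∑ i, a i * b i) ^ 2 := by
  simp only [cross_apply, Fin.sum_univ_three] at *
  simp
  linear_combination (a 0 ^ 2 + a 1 ^ 2 + a 2 ^ 2) * hb

theorem anti_zero (x y : Fin 3 → ℝ) (h : ∑ i, x i * y i = 0) :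
    pauliDot y * pauliDot x = -(pauliDot x * pauliDot y) := by
  have := pd_anti x y
  rw [h] at this
  simp at this
  exact eq_neg_of_add_eq_zero_right this

open ComplexOrder in
theorem eig_of_exp (b : Fin 3 → ℝ) (hb : ∑ i, b i ^ 2 = 1) (ψ : Fin 2 × Fin 2 → ℂ)
    (h1 : star ψ ⬝ᵥ ψ = 1)
    (h : star ψ ⬝ᵥ (pauliDot b ⊗ₖ pauliDot b) *ᵥ ψ = -1) :
    (pauliDot b ⊗ₖ pauliDot b) *ᵥ ψ = -ψ := by
  have hs := kr_sq b ψ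
  have hm := herm_move _ (kr_herm b b)
  set K := pauliDot b ⊗ₖ pauliDot b
  rw [hb] at hs
  have : star (K *ᵥ ψ + ψ) ⬝ᵥ (K *ᵥ ψ + ψ) = 0 := by
    rw [star_add, add_dotProduct, dotProduct_add, dotProduct_add, hm, hm, hs, h, h1]
    simp [h1]
  have := dotProduct_star_self_eq_zero.1 this
  exact eq_neg_of_add_eq_zero_left this

open ComplexOrder in
theorem upper (a b : Fin 3 → ℝ) (hb : ∑ i, b i ^ 2 = 1) (ψ : Fin 2 × Fin 2 → ℂ)
    (h1 : star ψ ⬝ᵥ ψ = 1)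
    (h : star ψ ⬝ᵥ (pauliDot b ⊗ₖ pauliDot b) *ᵥ ψ = -1) :
    (star ψ ⬝ᵥ (pauliDot a ⊗ₖ pauliDot a) *ᵥ ψ).re
      ≤ ∑ i, a i ^ 2 - 2 * (∑ i, a i * b i) ^ 2 := by
  have he := eig_of_exp b hb ψ h1 h
  set c := ∑ i, a i * b i with hc
  obtain ⟨d, hd⟩ : ∃ d, d = a - c • b := ⟨_, rfl⟩
  have had : a = c • b + d := by rw [hd]; abel
  have hbd : ∑ i, b i * d i = 0 := by
    simp only [hd, hc, Fin.sum_univ_three, Pi.sub_apply, Pi.smul_apply, smul_eq_mul] at *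
    linear_combination (-(a 0 * b 0 + a 1 * b 1 + a 2 * b 2)) * hb
  have hdd : ∑ i, d i ^ 2 = ∑ i, a i ^ 2 - c ^ 2 := by
    simp only [hd, hc, Fin.sum_univ_three, Pi.sub_apply, Pi.smul_apply, smul_eq_mul] at *
    linear_combination ((a 0 * b 0 + a 1 * b 1 + a 2 * b 2) ^ 2) * hb
  have hbb := pd_sq b
  rw [hb] at hbb
  have anti := anti_zero b d hbd
  have key : ∀ M : Matrix (Fin 2 × Fin 2) (Fin 2 × Fin 2) ℂ,
      M * (pauliDot b ⊗ₖ pauliDot b) = -((pauliDot b ⊗ₖ pauliDot b) * M) →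
      star ψ ⬝ᵥ M *ᵥ ψ = 0 := by
    intro M hM
    have e1 : star ψ ⬝ᵥ M *ᵥ ((pauliDot b ⊗ₖ pauliDot b) *ᵥ ψ) = - (star ψ ⬝ᵥ M *ᵥ ψ) := by
      rw [he, mulVec_neg, dotProduct_neg]
    rw [mulVec_mulVec, hM, neg_mulVec, dotProduct_neg, ← mulVec_mulVec,
      ← herm_move _ (kr_herm b b), he, star_neg, neg_dotProduct] at e1
    linear_combination e1 / 2
  have k1 : star ψ ⬝ᵥ (pauliDot b ⊗ₖ pauliDot d) *ᵥ ψ = 0 := by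
    apply key
    rw [← mul_kronecker_mul, ← mul_kronecker_mul, anti]
    ext ⟨i, j⟩ ⟨k, l⟩
    simp [kronecker_apply]
  have k2 : star ψ ⬝ᵥ (pauliDot d ⊗ₖ pauliDot b) *ᵥ ψ = 0 := by
    apply key
    rw [← mul_kronecker_mul, ← mul_kronecker_mul, anti]
    ext ⟨i, j⟩ ⟨k, l⟩
    simp [kronecker_apply]
  have hE : star ψ ⬝ᵥ (pauliDot a ⊗ₖ pauliDot a) *ᵥ ψ
      = -((c ^ 2 : ℝ) : ℂ) + star ψ ⬝ᵥ (pauliDot d ⊗ₖ pauliDot d) *ᵥ ψ := by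
    rw [had, pd_comb]
    simp only [add_kronecker, kronecker_add, smul_kronecker, kronecker_smul, add_mulVec,
      smul_mulVec, dotProduct_add, dotProduct_smul, k1, k2, h]
    simp
    ring
  have hfin : (star ψ ⬝ᵥ (pauliDot d ⊗ₖ pauliDot d) *ᵥ ψ).re ≤ ∑ i, d i ^ 2 := by
    have hs := kr_sq d ψ
    have hm := herm_move _ (kr_herm d d)
    have hr : 0 ≤ ∑ i, d i ^ 2 := Finset.sum_nonneg fun i _ => sq_nonneg _
    have hz : ∑ i, d i ^ 2 = 0 → pauliDot d ⊗ₖ pauliDot d = 0 := by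
      intro h0
      have : d = 0 := by
        ext i
        have := (Finset.sum_eq_zero_iff_of_nonneg (fun i _ => sq_nonneg (d i))).1 h0 i
          (Finset.mem_univ i)
        simpa using this
      simp [this, pauliDot]
    set K := pauliDot d ⊗ₖ pauliDot d
    set r := ∑ i, d i ^ 2
    rcases hr.eq_or_lt with h0 | h0
    · rw [hz h0.symm, ← h0]; simp
    have hp : 0 ≤ star ((r : ℂ) • ψ - K *ᵥ ψ) ⬝ᵥ ((r : ℂ) • ψ - K *ᵥ ψ) :=
      dotProduct_star_self_nonneg _
    have hq : star ((r : ℂ) • ψ - K *ᵥ ψ) ⬝ᵥ ((r : ℂ) • ψ - K *ᵥ ψ)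
        = ((2 * r ^ 2 : ℝ) : ℂ) - ((2 * r : ℝ) : ℂ) * (star ψ ⬝ᵥ K *ᵥ ψ) := by
      rw [star_sub, sub_dotProduct, dotProduct_sub, dotProduct_sub, hm, hm, hs]
      simp [dotProduct_smul, mulVec_smul, h1]
      ring
    rw [hq] at hp
    have := (Complex.le_def.1 hp).1
    rw [Complex.sub_re, Complex.re_ofReal_mul, Complex.ofReal_re, Complex.zero_re] at this
    nlinarith
  rw [hE, Complex.add_re, Complex.neg_re, Complex.ofReal_re]
  linarith

theorem kr_tensor (A B : Matrix (Fin 2) (Fin 2) ℂ) (u v : Fin 2 → ℂ) :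
    (A ⊗ₖ B) *ᵥ tensorC2 u v = tensorC2 (A *ᵥ u) (B *ᵥ v) := by
  ext ⟨i, j⟩
  simp [mulVec, dotProduct, tensorC2, Fintype.sum_prod_type, Fin.sum_univ_two]
  ring

theorem dot_tensor (u v u' v' : Fin 2 → ℂ) :
    star (tensorC2 u v) ⬝ᵥ tensorC2 u' v' = (star u ⬝ᵥ u') * (star v ⬝ᵥ v') := by
  simp [dotProduct, tensorC2, Fintype.sum_prod_type, Fin.sum_univ_two]
  ring

theorem probe (a b : Fin 3 → ℝ) (hb : ∑ i, b i ^ 2 = 1)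
    (φ χ : Fin 2 → ℂ)
    (h1 : star φ ⬝ᵥ φ = 1) (h2 : star χ ⬝ᵥ χ = 1) (h3 : star φ ⬝ᵥ χ = 0)
    (e1 : qubitEffect₁ b *ᵥ φ = φ) (e2 : qubitEffect₂ b *ᵥ χ = χ)
    (ψ : Fin 2 × Fin 2 → ℂ)
    (hψ : ψ = ((Real.sqrt 2 : ℂ))⁻¹ • (tensorC2 φ χ + tensorC2 χ φ)) :
    star ψ ⬝ᵥ ψ = 1 ∧
      star ψ ⬝ᵥ (pauliDot b ⊗ₖ pauliDot b) *ᵥ ψ = -1 ∧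
      star ψ ⬝ᵥ (pauliDot a ⊗ₖ pauliDot a) *ᵥ ψ
        = ((∑ i, a i ^ 2 - 2 * (∑ i, a i * b i) ^ 2 : ℝ) : ℂ) := by
  have h4 : star χ ⬝ᵥ φ = 0 := by
    have := congrArg star h3
    rw [← star_dotProduct_star] at this
    simpa [dotProduct_comm] using this
  have f1 : pauliDot b *ᵥ φ = φ := by
    rw [qubitEffect₁, smul_mulVec, add_mulVec, one_mulVec] at e1
    ext i
    have := congrFun e1 i
    rw [Pi.smul_apply, Pi.add_apply, smul_eq_mul] at this
    linear_combination 2 * this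
  have f2 : pauliDot b *ᵥ χ = -χ := by
    rw [qubitEffect₂, smul_mulVec, sub_mulVec, one_mulVec] at e2
    ext i
    have := congrFun e2 i
    rw [Pi.smul_apply, Pi.sub_apply, smul_eq_mul] at this
    rw [Pi.neg_apply]
    linear_combination -2 * this
  have hs2 : ((Real.sqrt 2 : ℂ))⁻¹ * ((Real.sqrt 2 : ℂ))⁻¹ = 1 / 2 := by
    rw [← mul_inv, ← Complex.ofReal_mul, Real.mul_self_sqrt (by norm_num)]
    norm_num
  have hgen : ∀ M : Matrix (Fin 2) (Fin 2) ℂ, star ψ ⬝ᵥ (M ⊗ₖ M) *ᵥ ψ =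
      (star φ ⬝ᵥ M *ᵥ φ) * (star χ ⬝ᵥ M *ᵥ χ) + (star φ ⬝ᵥ M *ᵥ χ) * (star χ ⬝ᵥ M *ᵥ φ) := by
    intro M
    rw [hψ, mulVec_smul, mulVec_add, kr_tensor, kr_tensor, star_smul, smul_dotProduct,
      dotProduct_smul, star_add, add_dotProduct, dotProduct_add, dotProduct_add,
      dot_tensor, dot_tensor, dot_tensor, dot_tensor]
    have : star ((Real.sqrt 2 : ℂ))⁻¹ = ((Real.sqrt 2 : ℂ))⁻¹ := by
      simp
    rw [this, smul_smul, hs2, smul_eq_mul]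
    ring
  refine ⟨?_, ?_, ?_⟩
  · have := hgen 1
    rw [one_kronecker_one] at this
    simpa [h1, h2, h3, h4] using this
  · rw [hgen, f1, f2]
    simp [h1, h2, h3, h4]
  · rw [hgen]
    have hm := herm_move _ (pd_herm b)
    have hanti := pd_anti a b
    have g1 : star φ ⬝ᵥ pauliDot a *ᵥ φ = ((∑ i, a i * b i : ℝ) : ℂ) := by
      have := congrArg (fun M => star φ ⬝ᵥ M *ᵥ φ) hanti
      simp only [add_mulVec, dotProduct_add, ← mulVec_mulVec, smul_mulVec, one_mulVec,
        dotProduct_smul] at this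
      rw [← hm, f1, h1, smul_eq_mul, Complex.ofReal_mul] at this
      push_cast at this ⊢
      linear_combination this / 2
    have g2 : star χ ⬝ᵥ pauliDot a *ᵥ χ = -((∑ i, a i * b i : ℝ) : ℂ) := by
      have := congrArg (fun M => star χ ⬝ᵥ M *ᵥ χ) hanti
      simp only [add_mulVec, dotProduct_add, ← mulVec_mulVec, smul_mulVec, one_mulVec,
        dotProduct_smul] at this
      rw [← hm, f2, h2, smul_eq_mul, mulVec_neg, star_neg, neg_dotProduct, dotProduct_neg,
        Complex.ofReal_mul] at this
      push_cast at this ⊢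
      linear_combination -this / 2
    -- completeness of the basis
    have hcomp : ∀ u v : Fin 2 → ℂ, star u ⬝ᵥ v
        = (star u ⬝ᵥ φ) * (star φ ⬝ᵥ v) + (star u ⬝ᵥ χ) * (star χ ⬝ᵥ v) := by
      have hU : !![star (φ 0), star (φ 1); star (χ 0), star (χ 1)] * !![φ 0, χ 0; φ 1, χ 1]
          = (1 : Matrix (Fin 2) (Fin 2) ℂ) := by
        simp only [dotProduct, Fin.sum_univ_two, Pi.star_apply] at h1 h2 h3 h4
        rw [Matrix.mul_fin_two, h1, h2, h3, h4, Matrix.one_fin_two]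
      have hU' := mul_eq_one_comm.1 hU
      rw [Matrix.mul_fin_two, Matrix.one_fin_two] at hU'
      have u00 := congrFun (congrFun hU' 0) 0
      have u01 := congrFun (congrFun hU' 0) 1
      have u10 := congrFun (congrFun hU' 1) 0
      have u11 := congrFun (congrFun hU' 1) 1
      simp only [of_apply, cons_val', cons_val_zero, cons_val_one, cons_val_fin_one]
        at u00 u01 u10 u11
      intro u v
      simp only [dotProduct, Fin.sum_univ_two, Pi.star_apply]
      linear_combination -(star (u 0) * v 0 * u00 + star (u 0) * v 1 * u01
        + star (u 1) * v 0 * u10 + star (u 1) * v 1 * u11)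
    have g3 := hcomp (pauliDot a *ᵥ φ) (pauliDot a *ᵥ φ)
    have hma := herm_move _ (pd_herm a)
    simp only [hma] at g3
    rw [mulVec_mulVec, pd_sq, smul_mulVec, one_mulVec, dotProduct_smul, h1, smul_eq_mul,
      g1] at g3
    rw [g1, g2]
    push_cast at g3 ⊢
    linear_combination -g3

theorem basis_exists (b : Fin 3 → ℝ) (hb : ∑ i, b i ^ 2 = 1) :
    ∃ φ χ : Fin 2 → ℂ, star φ ⬝ᵥ φ = 1 ∧ star χ ⬝ᵥ χ = 1 ∧ star φ ⬝ᵥ χ = 0 ∧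
      qubitEffect₁ b *ᵥ φ = φ ∧ qubitEffect₂ b *ᵥ χ = χ := by
  rw [Fin.sum_univ_three] at hb
  have hI := Complex.I_sq
  by_cases h : b 2 = -1
  · have h0 : b 0 = 0 := by nlinarith [sq_nonneg (b 0), sq_nonneg (b 1)]
    have h1 : b 1 = 0 := by nlinarith [sq_nonneg (b 0), sq_nonneg (b 1)]
    refine ⟨![0, 1], ![1, 0], ?_, ?_, ?_, ?_, ?_⟩
    · simp [dotProduct]
    · simp [dotProduct]
    · simp [dotProduct]
    · ext i
      fin_cases i <;> simp [qubitEffect₁, pauliDot, pauli, Fin.sum_univ_three, h, h0, h1,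
        mulVec, dotProduct] <;> norm_num
    · ext i
      fin_cases i <;> simp [qubitEffect₂, pauliDot, pauli, Fin.sum_univ_three, h, h0, h1,
        mulVec, dotProduct] <;> norm_num
  · have hpos : 0 < 2 * (1 + b 2) := by
      have : -1 ≤ b 2 := by nlinarith [sq_nonneg (b 0), sq_nonneg (b 1)]
      have := lt_of_le_of_ne this (Ne.symm h)
      linarith
    obtain ⟨t, ht⟩ : ∃ t : ℝ, t ^ 2 * (2 * (1 + b 2)) = 1 :=
      ⟨(Real.sqrt (2 * (1 + b 2)))⁻¹, by
        rw [inv_pow, Real.sq_sqrt hpos.le, inv_mul_cancel₀ hpos.ne']⟩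
    have hbC : (b 0 : ℂ) ^ 2 + (b 1 : ℂ) ^ 2 + (b 2 : ℂ) ^ 2 = 1 := by exact_mod_cast hb
    have htC : (t : ℂ) ^ 2 * (2 * (1 + (b 2 : ℂ))) = 1 := by exact_mod_cast ht
    refine ⟨![t * (1 + b 2), t * (b 0 + b 1 * Complex.I)],
      ![-(t * (b 0 - b 1 * Complex.I)), t * (1 + b 2)], ?_, ?_, ?_, ?_, ?_⟩
    · simp [dotProduct]
      linear_combination htC + (t : ℂ) ^ 2 * hbC - (t : ℂ) ^ 2 * (b 1 : ℂ) ^ 2 * hI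
    · simp [dotProduct]
      linear_combination htC + (t : ℂ) ^ 2 * hbC - (t : ℂ) ^ 2 * (b 1 : ℂ) ^ 2 * hI
    · simp [dotProduct]
      ring
    · ext i
      fin_cases i <;> simp [qubitEffect₁, pauliDot, pauli, Fin.sum_univ_three,
        mulVec, dotProduct]
      · linear_combination (t : ℂ) / 2 * hbC - (t : ℂ) / 2 * (b 1 : ℂ) ^ 2 * hI
      · ring
    · ext i
      fin_cases i <;> simp [qubitEffect₂, pauliDot, pauli, Fin.sum_univ_three,
        mulVec, dotProduct]
      · ring
      · linear_combination (t : ℂ) / 2 * hbC - (t : ℂ) / 2 * (b 1 : ℂ) ^ 2 * hI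

/-- Optimal two-shot unambiguous identification of a possibly unsharp qubit observable `A`
(associated to `a`, `0 < ‖a‖ ≤ 1`) against a sharp observable `B` (associated to the unit
vector `b`): the optimal success value is `‖a × b‖² + (1 − ‖a‖²)/2`, attained by the probe
state `(φ ⊗ φ⊥ + φ⊥ ⊗ φ)/√2` built from the eigenbasis of `B`; in particular it is nonzero
whenever `a ≠ ±b` or `‖a‖ < 1`, so `A` can be unambiguously identified. -/
theorem optimal_two_shot_identification_unsharp
    (a b : Fin 3 → ℝ)
    (ha0 : 0 < ∑ i, a i ^ 2) (ha1 : ∑ i, a i ^ 2 ≤ 1) (hb : ∑ i, b i ^ 2 = 1) :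
    IsGreatest {x : ℝ | ∃ ψ : Fin 2 × Fin 2 → ℂ, star ψ ⬝ᵥ ψ = 1 ∧
        star ψ ⬝ᵥ (qubitEffect₁ b ⊗ₖ qubitEffect₁ b + qubitEffect₂ b ⊗ₖ qubitEffect₂ b) *ᵥ ψ
          = 0 ∧
        star ψ ⬝ᵥ (qubitEffect₁ a ⊗ₖ qubitEffect₁ a + qubitEffect₂ a ⊗ₖ qubitEffect₂ a) *ᵥ ψ
          = (x : ℂ)}
      ((∑ i, (crossProduct a b) i ^ 2) + (1 - ∑ i, a i ^ 2) / 2) ∧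
    (∀ φ φperp : Fin 2 → ℂ,
      star φ ⬝ᵥ φ = 1 → star φperp ⬝ᵥ φperp = 1 → star φ ⬝ᵥ φperp = 0 →
      qubitEffect₁ b *ᵥ φ = φ → qubitEffect₂ b *ᵥ φperp = φperp →
      ∀ ψ : Fin 2 × Fin 2 → ℂ,
        ψ = ((Real.sqrt 2 : ℂ))⁻¹ • (tensorC2 φ φperp + tensorC2 φperp φ) →
        star ψ ⬝ᵥ ψ = 1 ∧
        star ψ ⬝ᵥ (qubitEffect₁ b ⊗ₖ qubitEffect₁ b + qubitEffect₂ b ⊗ₖ qubitEffect₂ b) *ᵥ ψ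
          = 0 ∧
        star ψ ⬝ᵥ (qubitEffect₁ a ⊗ₖ qubitEffect₁ a + qubitEffect₂ a ⊗ₖ qubitEffect₂ a) *ᵥ ψ
          = (((∑ i, (crossProduct a b) i ^ 2) + (1 - ∑ i, a i ^ 2) / 2 : ℝ) : ℂ)) ∧
    (((a ≠ b ∧ a ≠ -b) ∨ ∑ i, a i ^ 2 < 1) →
      (∑ i, (crossProduct a b) i ^ 2) + (1 - ∑ i, a i ^ 2) / 2 ≠ 0) := by
  have hcr := cross_id a b hb
  have hprobe : ∀ φ φperp : Fin 2 → ℂ,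
      star φ ⬝ᵥ φ = 1 → star φperp ⬝ᵥ φperp = 1 → star φ ⬝ᵥ φperp = 0 →
      qubitEffect₁ b *ᵥ φ = φ → qubitEffect₂ b *ᵥ φperp = φperp →
      ∀ ψ : Fin 2 × Fin 2 → ℂ,
        ψ = ((Real.sqrt 2 : ℂ))⁻¹ • (tensorC2 φ φperp + tensorC2 φperp φ) →
        star ψ ⬝ᵥ ψ = 1 ∧
        star ψ ⬝ᵥ (qubitEffect₁ b ⊗ₖ qubitEffect₁ b + qubitEffect₂ b ⊗ₖ qubitEffect₂ b) *ᵥ ψ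
          = 0 ∧
        star ψ ⬝ᵥ (qubitEffect₁ a ⊗ₖ qubitEffect₁ a + qubitEffect₂ a ⊗ₖ qubitEffect₂ a) *ᵥ ψ
          = (((∑ i, (crossProduct a b) i ^ 2) + (1 - ∑ i, a i ^ 2) / 2 : ℝ) : ℂ) := by
    intro φ χ h1 h2 h3 e1 e2 ψ hψ
    obtain ⟨p1, p2, p3⟩ := probe a b hb φ χ h1 h2 h3 e1 e2 ψ hψ
    refine ⟨p1, ?_, ?_⟩
    · rw [exp_eff b ψ p1, p2]; norm_num
    · rw [exp_eff a ψ p1, p3, hcr]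
      push_cast
      ring
  refine ⟨⟨?_, ?_⟩, hprobe, ?_⟩
  · obtain ⟨φ, χ, h1, h2, h3, e1, e2⟩ := basis_exists b hb
    exact ⟨_, hprobe φ χ h1 h2 h3 e1 e2 _ rfl⟩
  · rintro x ⟨ψ, h1, h2, h3⟩
    rw [exp_eff b ψ h1] at h2
    rw [exp_eff a ψ h1] at h3
    have hu := upper a b hb ψ h1 (by linear_combination 2 * h2)
    have h4 : star ψ ⬝ᵥ (pauliDot a ⊗ₖ pauliDot a) *ᵥ ψ = ((2 * x - 1 : ℝ) : ℂ) := by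
      push_cast
      linear_combination 2 * h3
    rw [h4, Complex.ofReal_re] at hu
    rw [hcr]
    linarith
  · intro hor h0
    have hn : 0 ≤ ∑ i, (crossProduct a b) i ^ 2 := Finset.sum_nonneg fun i _ => sq_nonneg _
    rcases hor with ⟨hab, hab'⟩ | hlt
    · have ha : ∑ i, a i ^ 2 = 1 := by linarith
      have hc : (∑ i, a i * b i) ^ 2 = 1 := by linarith
      have hsum : ∀ s : ℝ, s ^ 2 = 1 → ∑ i, a i * b i = s → ∀ i, a i = s * b i := by
        intro s hs hsab i
        have hz : ∑ i, (a i - s * b i) ^ 2 = 0 := by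
          simp only [Fin.sum_univ_three] at *
          linear_combination ha + s ^ 2 * hb - 2 * s * hsab - hs
        have := (Finset.sum_eq_zero_iff_of_nonneg
          (fun i _ => sq_nonneg (a i - s * b i))).1 hz i (Finset.mem_univ i)
        exact sub_eq_zero.1 (pow_eq_zero_iff (two_ne_zero) |>.1 this)
      rcases (sq_eq_sq_iff_eq_or_eq_neg.1 (hc.trans (one_pow 2).symm)) with h | h
      · exact hab (funext fun i => by simpa using hsum 1 (by norm_num) h i)
      · exact hab' (funext fun i => by simpa using hsum (-1) (by norm_num) h i)
    · linarith
end

section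
/- Let a, b ∈ ℝ³ be unit vectors and let A, B be the sharp qubit observables associated with a, b. Let {φ, φ⊥} be an orthonormal basis of ℂ² with A₁φ = φ, A₂φ⊥ = φ⊥, and {χ, χ⊥} an orthonormal basis with B₁χ = χ, B₂χ⊥ = χ⊥. Define the four-qubit unit vector ψ = (1/2)·(χ ⊗ χ⊥ + χ⊥ ⊗ χ) ⊗ (φ ⊗ φ⊥ + φ⊥ ⊗ φ) ∈ (ℂ²)^{⊗4}. Then: (i) ⟨ψ, ((B₁⊗B₁ + B₂⊗B₂) ⊗ I ⊗ I) ψ⟩ = 0; (ii) ⟨ψ, ((A₁⊗A₁ + A₂⊗A₂) ⊗ I ⊗ I) ψ⟩ = 1 − (a·b)²; (iii) ⟨ψ, (I ⊗ I ⊗ (A₁⊗A₁ + A₂⊗A₂)) ψ⟩ = 0; (iv) ⟨ψ, (I ⊗ I ⊗ (B₁⊗B₁ + B₂⊗B₂)) ψ⟩ = 1 − (a·b)². (Hence two sharp qubit observables can be unambiguously discriminated in four shots with success probability at least sin²θ_{ab} = 1 − (a·b)², regardless of the prior distribution.) -/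
open Matrix Kronecker

lemma aux_sum (b : Fin 3 → ℝ) : qubitEffect₁ b + qubitEffect₂ b = 1 := by
  unfold qubitEffect₁ qubitEffect₂
  rw [← smul_add, add_add_sub_cancel, ← two_smul ℂ (1 : Matrix (Fin 2) (Fin 2) ℂ), smul_smul]
  norm_num

lemma aux_proj (b : Fin 3 → ℝ) (χ χperp : Fin 2 → ℂ)
    (hχ : star χ ⬝ᵥ χ = 1) (hχperp : star χperp ⬝ᵥ χperp = 1)
    (hχorth : star χ ⬝ᵥ χperp = 0)
    (hBχ : qubitEffect₁ b *ᵥ χ = χ) (hBχperp : qubitEffect₂ b *ᵥ χperp = χperp) :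
    (∀ i j, χ i * star (χ j) = qubitEffect₁ b i j) ∧
    (∀ i j, χperp i * star (χperp j) = qubitEffect₂ b i j) := by
  have horth' : star χperp ⬝ᵥ χ = 0 := by
    have h := congrArg star hχorth
    rw [star_zero, Matrix.star_dotProduct, star_star] at h
    exact h
  have hU : (vecMulVec χ (star χ) + vecMulVec χperp (star χperp)) = 1 := by
    set U : Matrix (Fin 2) (Fin 2) ℂ := Matrix.of ![χ, χperp] with hUdef
    have h1 : U.map star * Uᵀ = 1 := by
      ext i j
      have e : (U.map star * Uᵀ) i j = star (U i) ⬝ᵥ U j := rfl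
      rw [e]
      fin_cases i <;> fin_cases j
      · simpa [U] using hχ
      · simpa [U] using hχorth
      · simpa [U] using horth'
      · simpa [U] using hχperp
    have h2 := mul_eq_one_comm.mp h1
    rw [← h2]
    ext i j
    simp [U, Matrix.mul_apply, vecMulVec_apply, Fin.sum_univ_two]
  have hs := aux_sum b
  have h1 : qubitEffect₁ b *ᵥ χperp = 0 := by
    have : qubitEffect₁ b = 1 - qubitEffect₂ b := eq_sub_of_add_eq hs
    rw [this, sub_mulVec, hBχperp, one_mulVec, sub_self]
  have hB1 : qubitEffect₁ b = vecMulVec χ (star χ) := by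
    calc qubitEffect₁ b = qubitEffect₁ b * 1 := (mul_one _).symm
      _ = _ := by rw [← hU, mul_add, mul_vecMulVec, mul_vecMulVec, hBχ, h1]; simp
  have hB2 : qubitEffect₂ b = vecMulVec χperp (star χperp) := by
    have : qubitEffect₂ b = 1 - qubitEffect₁ b := eq_sub_of_add_eq' hs
    rw [this, ← hU, hB1, add_sub_cancel_left]
  constructor
  · intro i j; rw [hB1]; rfl
  · intro i j; rw [hB2]; rfl

lemma aux_outer (b : Fin 3 → ℝ) (χ χperp : Fin 2 → ℂ)
    (h1 : ∀ i j, χ i * star (χ j) = qubitEffect₁ b i j)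
    (h2 : ∀ i j, χperp i * star (χperp j) = qubitEffect₂ b i j)
    (S : Fin 2 × Fin 2 → ℂ) (hS : S = tensorC2 χ χperp + tensorC2 χperp χ)
    (X : Matrix (Fin 2 × Fin 2) (Fin 2 × Fin 2) ℂ) :
    star S ⬝ᵥ X *ᵥ S = ∑ p, ∑ q, X p q *
      (qubitEffect₁ b q.1 p.1 * qubitEffect₂ b q.2 p.2
        + qubitEffect₁ b q.1 p.2 * qubitEffect₂ b q.2 p.1
        + qubitEffect₁ b q.2 p.1 * qubitEffect₂ b q.1 p.2
        + qubitEffect₁ b q.2 p.2 * qubitEffect₂ b q.1 p.1) := by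
  simp only [dotProduct, mulVec, Finset.mul_sum]
  refine Finset.sum_congr rfl fun p _ => Finset.sum_congr rfl fun q _ => ?_
  simp only [← h1, ← h2, hS, tensorC2, Pi.star_apply, Pi.add_apply, star_add, star_mul]
  ring

lemma aux_entries_s12 (a : Fin 3 → ℝ) :
    qubitEffect₁ a = !![(1 + (a 2 : ℂ))/2, ((a 0 : ℂ) - (a 1 : ℂ) * Complex.I)/2;
      ((a 0 : ℂ) + (a 1 : ℂ) * Complex.I)/2, (1 - (a 2 : ℂ))/2] ∧
    qubitEffect₂ a = !![(1 - (a 2 : ℂ))/2, (-(a 0 : ℂ) + (a 1 : ℂ) * Complex.I)/2;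
      (-(a 0 : ℂ) - (a 1 : ℂ) * Complex.I)/2, (1 + (a 2 : ℂ))/2] := by
  constructor <;> ext i j <;> fin_cases i <;> fin_cases j <;>
    simp [qubitEffect₁, qubitEffect₂, pauliDot, pauli, Fin.sum_univ_three] <;> ring

lemma aux_val (a b : Fin 3 → ℝ)
    (ha : ∑ i, a i ^ 2 = 1) (χ χperp : Fin 2 → ℂ)
    (h1 : ∀ i j, χ i * star (χ j) = qubitEffect₁ b i j)
    (h2 : ∀ i j, χperp i * star (χperp j) = qubitEffect₂ b i j)
    (S : Fin 2 × Fin 2 → ℂ) (hS : S = tensorC2 χ χperp + tensorC2 χperp χ) :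
    star S ⬝ᵥ (qubitEffect₁ a ⊗ₖ qubitEffect₁ a + qubitEffect₂ a ⊗ₖ qubitEffect₂ a) *ᵥ S
      = 2 * ((1 - (∑ i, a i * b i) ^ 2 : ℝ) : ℂ) := by
  rw [aux_outer b χ χperp h1 h2 S hS]
  have ha' : (a 0 : ℂ)^2 + (a 1 : ℂ)^2 + (a 2 : ℂ)^2 = 1 := by
    rw [Fin.sum_univ_three] at ha
    exact_mod_cast ha
  rw [(aux_entries_s12 a).1, (aux_entries_s12 a).2, (aux_entries_s12 b).1, (aux_entries_s12 b).2]
  simp only [Fintype.sum_prod_type, Fin.sum_univ_two, Fin.sum_univ_three, Matrix.add_apply,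
    kroneckerMap_apply, of_apply, cons_val', cons_val_zero, cons_val_one, cons_val_fin_one]
  push_cast
  have hI := Complex.I_sq
  have hI4 : Complex.I ^ 4 = 1 := Complex.I_pow_four
  have hI3 : Complex.I ^ 3 = -Complex.I := Complex.I_pow_three
  ring_nf
  simp only [hI, hI3, hI4]
  linear_combination ((1 + (b 0 : ℂ)^2 + (b 1 : ℂ)^2 + (b 2 : ℂ)^2)/2) * ha'

lemma aux_one (b : Fin 3 → ℝ) (hb : ∑ i, b i ^ 2 = 1) (χ χperp : Fin 2 → ℂ)
    (h1 : ∀ i j, χ i * star (χ j) = qubitEffect₁ b i j)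
    (h2 : ∀ i j, χperp i * star (χperp j) = qubitEffect₂ b i j)
    (S : Fin 2 × Fin 2 → ℂ) (hS : S = tensorC2 χ χperp + tensorC2 χperp χ) :
    star S ⬝ᵥ ((1 : Matrix (Fin 2) (Fin 2) ℂ) ⊗ₖ (1 : Matrix (Fin 2) (Fin 2) ℂ)) *ᵥ S = 2 := by
  rw [aux_outer b χ χperp h1 h2 S hS]
  have hb' : (b 0 : ℂ)^2 + (b 1 : ℂ)^2 + (b 2 : ℂ)^2 = 1 := by
    rw [Fin.sum_univ_three] at hb
    exact_mod_cast hb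
  rw [(aux_entries_s12 b).1, (aux_entries_s12 b).2]
  simp [Fintype.sum_prod_type, Fin.sum_univ_two, Matrix.one_apply]
  linear_combination -hb' + (b 1 : ℂ)^2 * Complex.I_sq

lemma aux_fac (S T : Fin 2 × Fin 2 → ℂ) (X Y : Matrix (Fin 2 × Fin 2) (Fin 2 × Fin 2) ℂ)
    (ψ : (Fin 2 × Fin 2) × (Fin 2 × Fin 2) → ℂ)
    (hψ : ψ = fun p => (2 : ℂ)⁻¹ * (S p.1 * T p.2)) :
    star ψ ⬝ᵥ (X ⊗ₖ Y) *ᵥ ψ = 4⁻¹ * ((star S ⬝ᵥ X *ᵥ S) * (star T ⬝ᵥ Y *ᵥ T)) := by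
  have h1 : (X ⊗ₖ Y) *ᵥ ψ = fun p => (2 : ℂ)⁻¹ * ((X *ᵥ S) p.1 * (Y *ᵥ T) p.2) := by
    ext p
    simp only [mulVec, dotProduct]
    rw [Finset.sum_mul_sum, Finset.mul_sum, Fintype.sum_prod_type]
    refine Finset.sum_congr rfl fun i _ => ?_
    rw [Finset.mul_sum]
    refine Finset.sum_congr rfl fun j _ => ?_
    simp only [hψ, kroneckerMap_apply]; ring
  rw [h1]
  simp only [dotProduct]
  rw [Finset.sum_mul_sum, Finset.mul_sum, Fintype.sum_prod_type]
  refine Finset.sum_congr rfl fun i _ => ?_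
  rw [Finset.mul_sum]
  refine Finset.sum_congr rfl fun j _ => ?_
  have h2 : star (2⁻¹ : ℂ) = 2⁻¹ := by simp
  simp only [hψ, Pi.star_apply, star_mul, h2]; ring

/-- Unambiguous discrimination of two sharp qubit observables in four shots: the probe state
`ψ = (χ ⊗ χ⊥ + χ⊥ ⊗ χ)/√2 ⊗ (φ ⊗ φ⊥ + φ⊥ ⊗ φ)/√2` annihilates the "same outcomes" effect of
`B` on the first pair and of `A` on the second pair, while giving probability `1 − (a·b)²` to
the corresponding conclusive events for `A` and `B` respectively. -/
theorem four_shot_unambiguous_discrimination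
    (a b : Fin 3 → ℝ)
    (ha : ∑ i, a i ^ 2 = 1) (hb : ∑ i, b i ^ 2 = 1)
    (φ φperp χ χperp : Fin 2 → ℂ)
    (hφ : star φ ⬝ᵥ φ = 1) (hφperp : star φperp ⬝ᵥ φperp = 1)
    (hφorth : star φ ⬝ᵥ φperp = 0)
    (hAφ : qubitEffect₁ a *ᵥ φ = φ) (hAφperp : qubitEffect₂ a *ᵥ φperp = φperp)
    (hχ : star χ ⬝ᵥ χ = 1) (hχperp : star χperp ⬝ᵥ χperp = 1)
    (hχorth : star χ ⬝ᵥ χperp = 0)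
    (hBχ : qubitEffect₁ b *ᵥ χ = χ) (hBχperp : qubitEffect₂ b *ᵥ χperp = χperp)
    (ψ : (Fin 2 × Fin 2) × (Fin 2 × Fin 2) → ℂ)
    (hψ : ψ = fun p => (2 : ℂ)⁻¹ * ((tensorC2 χ χperp + tensorC2 χperp χ) p.1 *
      (tensorC2 φ φperp + tensorC2 φperp φ) p.2)) :
    star ψ ⬝ᵥ ((qubitEffect₁ b ⊗ₖ qubitEffect₁ b + qubitEffect₂ b ⊗ₖ qubitEffect₂ b) ⊗ₖ
        ((1 : Matrix (Fin 2) (Fin 2) ℂ) ⊗ₖ (1 : Matrix (Fin 2) (Fin 2) ℂ))) *ᵥ ψ = 0 ∧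
    star ψ ⬝ᵥ ((qubitEffect₁ a ⊗ₖ qubitEffect₁ a + qubitEffect₂ a ⊗ₖ qubitEffect₂ a) ⊗ₖ
        ((1 : Matrix (Fin 2) (Fin 2) ℂ) ⊗ₖ (1 : Matrix (Fin 2) (Fin 2) ℂ))) *ᵥ ψ
      = ((1 - (∑ i, a i * b i) ^ 2 : ℝ) : ℂ) ∧
    star ψ ⬝ᵥ (((1 : Matrix (Fin 2) (Fin 2) ℂ) ⊗ₖ (1 : Matrix (Fin 2) (Fin 2) ℂ)) ⊗ₖ
        (qubitEffect₁ a ⊗ₖ qubitEffect₁ a + qubitEffect₂ a ⊗ₖ qubitEffect₂ a)) *ᵥ ψ = 0 ∧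
    star ψ ⬝ᵥ (((1 : Matrix (Fin 2) (Fin 2) ℂ) ⊗ₖ (1 : Matrix (Fin 2) (Fin 2) ℂ)) ⊗ₖ
        (qubitEffect₁ b ⊗ₖ qubitEffect₁ b + qubitEffect₂ b ⊗ₖ qubitEffect₂ b)) *ᵥ ψ
      = ((1 - (∑ i, a i * b i) ^ 2 : ℝ) : ℂ) := by
  obtain ⟨a1, a2⟩ := aux_proj a φ φperp hφ hφperp hφorth hAφ hAφperp
  obtain ⟨b1, b2⟩ := aux_proj b χ χperp hχ hχperp hχorth hBχ hBχperp
  have haa : ∑ i, a i * a i = 1 := by simpa only [sq] using ha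
  have hbb : ∑ i, b i * b i = 1 := by simpa only [sq] using hb
  refine ⟨?_, ?_, ?_, ?_⟩
  · rw [aux_fac _ _ _ _ ψ hψ, aux_val b b hb χ χperp b1 b2 _ rfl, hbb]
    simp
  · rw [aux_fac _ _ _ _ ψ hψ, aux_val a b ha χ χperp b1 b2 _ rfl,
      aux_one a ha φ φperp a1 a2 _ rfl]
    ring
  · rw [aux_fac _ _ _ _ ψ hψ, aux_val a a ha φ φperp a1 a2 _ rfl, haa]
    simp
  · rw [aux_fac _ _ _ _ ψ hψ, aux_val b a hb φ φperp a1 a2 _ rfl,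
      aux_one b hb χ χperp b1 b2 _ rfl]
    simp only [mul_comm (b _) (a _)]
    ring
end

section
/- Let {φ, φ⊥} be an orthonormal basis of ℂ², let r ∈ ℝ, and set φ± = (φ ± e^{ir} φ⊥)/√2. Define A₁ = |φ⟩⟨φ|, A₂ = |φ⊥⟩⟨φ⊥|, B₁ = |φ₊⟩⟨φ₊|, B₂ = |φ₋⟩⟨φ₋|, and the unit vector ψ = (φ ⊗ φ⊥ + φ⊥ ⊗ φ)/√2 ∈ ℂ² ⊗ ℂ². Then B₁ + B₂ = I (so both pairs are two-outcome POVMs), and ⟨ψ, (A₁⊗A₁) ψ⟩ = ⟨ψ, (A₂⊗A₂) ψ⟩ = 0 while ⟨ψ, (B₁⊗B₂) ψ⟩ = ⟨ψ, (B₂⊗B₁) ψ⟩ = 0. Hence the probe state ψ perfectly discriminates A from B in two shots: equal outcomes imply the measured observable is B, different outcomes imply it is A. -/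
open Matrix Kronecker

theorem prob_zero_aux (a b φ χ : Fin 2 → ℂ) (c : ℂ)
    (h : (star a ⬝ᵥ φ) * (star b ⬝ᵥ χ) + (star a ⬝ᵥ χ) * (star b ⬝ᵥ φ) = 0) :
    star (c • (tensorC2 φ χ + tensorC2 χ φ)) ⬝ᵥ
      ((Matrix.vecMulVec a (star a)) ⊗ₖ (Matrix.vecMulVec b (star b))) *ᵥ
        (c • (tensorC2 φ χ + tensorC2 χ φ)) = 0 := by
  have key : ((Matrix.vecMulVec a (star a)) ⊗ₖ (Matrix.vecMulVec b (star b))) *ᵥ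
        (c • (tensorC2 φ χ + tensorC2 χ φ)) = 0 := by
    ext ⟨i, j⟩
    simp only [Matrix.mulVec, dotProduct, Fintype.sum_prod_type, Fin.sum_univ_two,
      Matrix.kroneckerMap_apply, Matrix.vecMulVec_apply, tensorC2, Pi.smul_apply, Pi.add_apply,
      smul_eq_mul, Pi.star_apply, Pi.zero_apply] at h ⊢
    linear_combination (c * a i * b j) * h
  rw [key, dotProduct_zero]

theorem resolution_aux (φ χ : Fin 2 → ℂ)
    (hφ : star φ ⬝ᵥ φ = 1) (hχ : star χ ⬝ᵥ χ = 1) (h : star φ ⬝ᵥ χ = 0) :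
    Matrix.vecMulVec φ (star φ) + Matrix.vecMulVec χ (star χ) = 1 := by
  have h' : star χ ⬝ᵥ φ = 0 := by
    have := congrArg star h
    simpa [dotProduct, Fin.sum_univ_two, mul_comm] using this
  have hU : (Matrix.of ![star φ, star χ]) * (Matrix.of ![φ, χ])ᵀ = 1 := by
    ext i j
    fin_cases i <;> fin_cases j <;>
      simp [Matrix.mul_apply, dotProduct, Fin.sum_univ_two] at hφ hχ h h' ⊢ <;> assumption
  have hV := mul_eq_one_comm.mp hU
  rw [← hV]
  ext i j
  simp [Matrix.mul_apply, Fin.sum_univ_two, Matrix.vecMulVec_apply]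

/-- Perfect two-shot discrimination of two sharp qubit observables associated with mutually
unbiased bases: with `A₁ = |φ⟩⟨φ|`, `A₂ = |φ⊥⟩⟨φ⊥|`, `B₁ = |φ₊⟩⟨φ₊|`, `B₂ = |φ₋⟩⟨φ₋|` where
`φ± = (φ ± e^{ir} φ⊥)/√2`, the probe state `ψ = (φ ⊗ φ⊥ + φ⊥ ⊗ φ)/√2` gives zero probability
to equal outcomes for `A` and to different outcomes for `B`. -/
theorem perfect_two_shot_discrimination_qubit
    (φ φperp : Fin 2 → ℂ)
    (hφ : star φ ⬝ᵥ φ = 1) (hφperp : star φperp ⬝ᵥ φperp = 1)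
    (horth : star φ ⬝ᵥ φperp = 0)
    (r : ℝ)
    (φplus φminus : Fin 2 → ℂ)
    (hplus : φplus = ((Real.sqrt 2 : ℂ))⁻¹ • (φ + Complex.exp (r * Complex.I) • φperp))
    (hminus : φminus = ((Real.sqrt 2 : ℂ))⁻¹ • (φ - Complex.exp (r * Complex.I) • φperp))
    (A₁ A₂ B₁ B₂ : Matrix (Fin 2) (Fin 2) ℂ)
    (hA₁ : A₁ = Matrix.vecMulVec φ (star φ))
    (hA₂ : A₂ = Matrix.vecMulVec φperp (star φperp))
    (hB₁ : B₁ = Matrix.vecMulVec φplus (star φplus))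
    (hB₂ : B₂ = Matrix.vecMulVec φminus (star φminus))
    (ψ : Fin 2 × Fin 2 → ℂ)
    (hψ : ψ = ((Real.sqrt 2 : ℂ))⁻¹ • (tensorC2 φ φperp + tensorC2 φperp φ)) :
    B₁ + B₂ = 1 ∧
    star ψ ⬝ᵥ (A₁ ⊗ₖ A₁) *ᵥ ψ = 0 ∧ star ψ ⬝ᵥ (A₂ ⊗ₖ A₂) *ᵥ ψ = 0 ∧
    star ψ ⬝ᵥ (B₁ ⊗ₖ B₂) *ᵥ ψ = 0 ∧ star ψ ⬝ᵥ (B₂ ⊗ₖ B₁) *ᵥ ψ = 0 := by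
  have h' : star φperp ⬝ᵥ φ = 0 := by
    have := congrArg star horth
    simpa [dotProduct, Fin.sum_univ_two, mul_comm] using this
  have hc : ((Real.sqrt 2 : ℂ))⁻¹ * ((Real.sqrt 2 : ℂ))⁻¹ = 1 / 2 := by
    rw [← mul_inv, ← Complex.ofReal_mul, Real.mul_self_sqrt (by norm_num)]
    norm_num
  have hsc : star ((Real.sqrt 2 : ℂ))⁻¹ = ((Real.sqrt 2 : ℂ))⁻¹ := by
    simp
  have he : Complex.exp (r * Complex.I) * star (Complex.exp (r * Complex.I)) = 1 := by
    rw [Complex.star_def, Complex.mul_conj, Complex.normSq_eq_norm_sq,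
      Complex.norm_exp_ofReal_mul_I]
    norm_num
  generalize ((Real.sqrt 2 : ℂ))⁻¹ = c at *
  generalize Complex.exp (r * Complex.I) = e at *
  have p1 : star φplus ⬝ᵥ φ = c := by
    simp [hplus, add_dotProduct, hφ, h', hsc, -RCLike.star_def]
  have p2 : star φplus ⬝ᵥ φperp = c * star e := by
    simp [hplus, add_dotProduct, hφperp, horth, hsc, -RCLike.star_def]
  have m1 : star φminus ⬝ᵥ φ = c := by
    simp [hminus, sub_dotProduct, hφ, h', hsc, -RCLike.star_def]
  have m2 : star φminus ⬝ᵥ φperp = -(c * star e) := by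
    simp [hminus, sub_dotProduct, hφperp, horth, hsc, -RCLike.star_def]
  refine ⟨?_, ?_, ?_, ?_, ?_⟩
  · rw [← resolution_aux φ φperp hφ hφperp horth, hB₁, hB₂, hplus, hminus]
    ext i j
    simp only [Matrix.add_apply, Matrix.vecMulVec_apply, Pi.smul_apply, Pi.add_apply,
      Pi.sub_apply, Pi.star_apply, smul_eq_mul, star_mul', star_add, star_sub, hsc]
    linear_combination (2 * φ i * star (φ j) + 2 * (e * star e) * φperp i * star (φperp j)) * hc
      + φperp i * star (φperp j) * he
  · rw [hψ, hA₁]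
    exact prob_zero_aux _ _ _ _ _ (by rw [horth]; ring)
  · rw [hψ, hA₂]
    exact prob_zero_aux _ _ _ _ _ (by rw [h']; ring)
  · rw [hψ, hB₁, hB₂]
    exact prob_zero_aux _ _ _ _ _ (by rw [p1, p2, m1, m2]; ring)
  · rw [hψ, hB₁, hB₂]
    exact prob_zero_aux _ _ _ _ _ (by rw [p1, p2, m1, m2]; ring)
end
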